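/- Let G be a finitely generated elementary amenable group with ω(G) = 1 (i.e., zero algebraic entropy). Then G contains a nilpotent subgroup of finite index. -/

import Mathlib

section GrowthDefs

variable {G : Type*} [Group G]

/-- The ball of radius `n` w.r.t. a finite set `X`: all elements of `G` that are products
of at most `n` letters from `X ∪ X⁻¹`. -/
def wordBall (X : Finset G) (n : ℕ) : Set G :=
  {g | ∃ l : List G, l.length ≤ n ∧ (∀ x ∈ l, x ∈ X ∨ x⁻¹ ∈ X) ∧ l.prod = g}

/-- The growth function `γ_G^X(n) = card {g ∈ G : ‖g‖_X ≤ n}`. -/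
noncomputable def growthFn (X : Finset G) (n : ℕ) : ℕ :=
  Nat.card (wordBall X n)

/-- The exponential growth rate `ω(G,X) = lim_{n→∞} γ_G^X(n)^{1/n}`, which by
submultiplicativity of the growth function equals `inf_{n ≥ 1} γ_G^X(n)^{1/n}`. -/
noncomputable def growthRateX (X : Finset G) : ℝ :=
  ⨅ n : ℕ, (growthFn X (n + 1) : ℝ) ^ ((1 : ℝ) / (n + 1))

/-- The minimal exponential growth rate `ω(G) = inf_X ω(G,X)`, the infimum being taken
over all finite generating sets `X` of `G`. -/
noncomputable def minGrowthRate (G : Type*) [Group G] : ℝ :=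
  sInf {r : ℝ | ∃ X : Finset G, Subgroup.closure (X : Set G) = ⊤ ∧ r = growthRateX X}

/-- `G` has exponential growth: `ω(G,X) > 1` for some (equivalently, every) finite
generating set `X`. -/
def HasExponentialGrowth (G : Type*) [Group G] : Prop :=
  ∃ X : Finset G, Subgroup.closure (X : Set G) = ⊤ ∧ 1 < growthRateX X

end GrowthDefs

universe u

/-- The class `EG` of elementary amenable groups: the smallest class of groups containing
all abelian groups and all finite groups and closed under taking subgroups, taking
quotient groups, group extensions and direct limits (directed unions). -/
inductive ElementaryAmenable : (G : Type u) → Group G → Prop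
  | abelian (G : Type u) [inst : Group G] (h : ∀ a b : G, a * b = b * a) :
      ElementaryAmenable G inst
  | finite (G : Type u) [inst : Group G] (h : Finite G) : ElementaryAmenable G inst
  | subgroup {G H : Type u} [instG : Group G] [instH : Group H] (f : H →* G)
      (hf : Function.Injective f) (hG : ElementaryAmenable G instG) :
      ElementaryAmenable H instH
  | quotient {G H : Type u} [instG : Group G] [instH : Group H] (f : G →* H)
      (hf : Function.Surjective f) (hG : ElementaryAmenable G instG) :
      ElementaryAmenable H instH
  | extension {G : Type u} [instG : Group G] (N : Subgroup G) [hN : N.Normal]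
      (h1 : ElementaryAmenable N inferInstance)
      (h2 : ElementaryAmenable (G ⧸ N) inferInstance) :
      ElementaryAmenable G instG
  | directedUnion {G : Type u} [instG : Group G] {ι : Type u} (K : ι → Subgroup G)
      (hdir : Directed (· ≤ ·) K) (htop : ⨆ i, K i = ⊤)
      (h : ∀ i, ElementaryAmenable (K i) inferInstance) :
      ElementaryAmenable G instG

section WordBall

variable {G : Type*} [Group G] {X : Finset G} {m n : ℕ} {a b g h : G}

lemma one_mem_wordBall (X : Finset G) (n : ℕ) : (1 : G) ∈ wordBall X n :=
  ⟨[], by simp, by simp, rfl⟩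

lemma wordBall_mono (X : Finset G) (hmn : m ≤ n) : wordBall X m ⊆ wordBall X n :=
  fun _ ⟨l, h1, h2, h3⟩ => ⟨l, h1.trans hmn, h2, h3⟩

lemma mem_wordBall_one (h : g ∈ X ∨ g⁻¹ ∈ X) : g ∈ wordBall X 1 :=
  ⟨[g], by simp, by simpa using h, by simp⟩

lemma mul_mem_wordBall (hg : g ∈ wordBall X m) (hh : h ∈ wordBall X n) :
    g * h ∈ wordBall X (m + n) := by
  obtain ⟨l, h1, h2, rfl⟩ := hg
  obtain ⟨l', h1', h2', rfl⟩ := hh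
  refine ⟨l ++ l', by simp; omega, fun x hx => ?_, by simp⟩
  rcases List.mem_append.1 hx with hx | hx
  exacts [h2 x hx, h2' x hx]

lemma inv_mem_wordBall (hg : g ∈ wordBall X m) : g⁻¹ ∈ wordBall X m := by
  obtain ⟨l, h1, h2, rfl⟩ := hg
  refine ⟨(l.map (·⁻¹)).reverse, by simpa using h1, fun x hx => ?_, by rw [List.prod_inv_reverse]⟩
  simp only [List.mem_reverse, List.mem_map] at hx
  obtain ⟨y, hy, rfl⟩ := hx
  simpa using (h2 y hy).symm

lemma pow_mem_wordBall (hg : g ∈ wordBall X m) (k : ℕ) : g ^ k ∈ wordBall X (k * m) := by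
  induction k with
  | zero => simpa using one_mem_wordBall X _
  | succ k ih => rw [pow_succ, Nat.succ_mul]; exact mul_mem_wordBall ih hg

lemma exists_mul_of_mem_wordBall_add (hg : g ∈ wordBall X (m + n)) :
    ∃ a ∈ wordBall X m, ∃ b ∈ wordBall X n, a * b = g := by
  obtain ⟨l, h1, h2, rfl⟩ := hg
  refine ⟨_, ⟨l.take m, by simp, fun x hx => h2 x (List.mem_of_mem_take hx), rfl⟩,
    _, ⟨l.drop m, by simp; omega, fun x hx => h2 x (List.mem_of_mem_drop hx), rfl⟩, ?_⟩
  rw [← List.prod_append, List.take_append_drop]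

lemma wordBall_one_finite (X : Finset G) : (wordBall X 1).Finite := by
  refine ((X.finite_toSet.union X.finite_toSet.inv).union (Set.finite_singleton (1 : G))).subset ?_
  rintro _ ⟨l, h1, h2, rfl⟩
  match l, h1 with
  | [], _ => simp
  | [x], _ => simpa using Or.inr (h2 x (by simp))

open Pointwise in
lemma wordBall_finite (X : Finset G) (n : ℕ) : (wordBall X n).Finite := by
  induction n with
  | zero => exact (wordBall_one_finite X).subset (wordBall_mono X (Nat.zero_le 1))
  | succ n ih =>
    refine (ih.mul (wordBall_one_finite X)).subset fun g hg => ?_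
    obtain ⟨a, ha, b, hb, rfl⟩ := exists_mul_of_mem_wordBall_add hg
    exact Set.mul_mem_mul ha hb

lemma exists_mem_wordBall (hg : g ∈ Subgroup.closure (X : Set G)) : ∃ n, g ∈ wordBall X n := by
  induction hg using Subgroup.closure_induction with
  | mem x hx => exact ⟨1, mem_wordBall_one (.inl hx)⟩
  | one => exact ⟨0, one_mem_wordBall X 0⟩
  | mul x y _ _ hx hy =>
    obtain ⟨m, hm⟩ := hx
    obtain ⟨n, hn⟩ := hy
    exact ⟨_, mul_mem_wordBall hm hn⟩
  | inv x _ hx =>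
    obtain ⟨m, hm⟩ := hx
    exact ⟨_, inv_mem_wordBall hm⟩

lemma map_mem_wordBall_of_forall_mem {H : Type*} [Group H] {Y : Finset H} (f : H →* G) {L k : ℕ}
    (hY : ∀ y ∈ Y, f y ∈ wordBall X L) {g : H} (hg : g ∈ wordBall Y k) :
    f g ∈ wordBall X (k * L) := by
  obtain ⟨l, h1, h2, rfl⟩ := hg
  refine wordBall_mono X (Nat.mul_le_mul_right L h1) ?_
  clear h1
  induction l with
  | nil => simpa using one_mem_wordBall X _
  | cons x l ih =>
    rw [List.prod_cons, map_mul, List.length_cons, Nat.succ_mul, Nat.add_comm]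
    refine mul_mem_wordBall ?_ (ih fun y hy => h2 y (List.mem_cons_of_mem _ hy))
    rcases h2 x (by simp) with h | h
    · exact hY x h
    · simpa using inv_mem_wordBall (hY _ h)

lemma exists_mem_wordBall_of_mem_wordBall_image {H : Type*} [Group H] [DecidableEq H] (f : G →* H)
    {k : ℕ} {g : H} (hg : g ∈ wordBall (X.image f) k) : ∃ g' ∈ wordBall X k, f g' = g := by
  obtain ⟨l, h1, h2, rfl⟩ := hg
  suffices H : ∃ l' : List G, l'.length = l.length ∧ (∀ x ∈ l', x ∈ X ∨ x⁻¹ ∈ X) ∧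
      f l'.prod = l.prod by
    obtain ⟨l', h3, h4, h5⟩ := H
    exact ⟨l'.prod, ⟨l', h3.trans_le h1, h4, rfl⟩, h5⟩
  clear h1
  induction l with
  | nil => exact ⟨[], by simp⟩
  | cons x l ih =>
    obtain ⟨l', h3, h4, h5⟩ := ih fun y hy => h2 y (List.mem_cons_of_mem _ hy)
    have : ∃ y : G, (y ∈ X ∨ y⁻¹ ∈ X) ∧ f y = x := by
      rcases h2 x (by simp) with h | h
      · obtain ⟨y, hy, rfl⟩ := Finset.mem_image.1 h
        exact ⟨y, .inl hy, rfl⟩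
      · obtain ⟨y, hy, hyx⟩ := Finset.mem_image.1 h
        exact ⟨y⁻¹, .inr (by simpa using hy), by simp [hyx]⟩
    obtain ⟨y, hy, rfl⟩ := this
    refine ⟨y :: l', by simp [h3], ?_, by simp [← h5]⟩
    simpa [hy] using h4

/-- Short words represent every coset of a normal subgroup of finite index. -/
lemma exists_mem_wordBall_index (hX : Subgroup.closure (X : Set G) = ⊤) (H : Subgroup G)
    [H.Normal] [H.FiniteIndex] (g : G) : ∃ r ∈ wordBall X H.index, (r : G ⧸ H) = g := by
  let F : ℕ → Set (G ⧸ H) := fun n => (fun x : G => (x : G ⧸ H)) '' wordBall X n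
  have hF : Monotone F := fun m n hmn => Set.image_mono (wordBall_mono X hmn)
  have hstab : ∀ m, (F m).ncard = (F (m + 1)).ncard → (F (m + 1)).ncard = (F (m + 2)).ncard := by
    intro m hm
    have hm' : F m = F (m + 1) :=
      Set.eq_of_subset_of_ncard_le (hF (Nat.le_succ m)) hm.ge (Set.toFinite _)
    congr 1
    refine (hF (Nat.le_succ _)).antisymm ?_
    rintro _ ⟨x, hx, rfl⟩
    obtain ⟨a, ha, b, hb, rfl⟩ := exists_mul_of_mem_wordBall_add (m := m + 1) (n := 1) hx
    have : (a : G ⧸ H) ∈ F m := hm' ▸ ⟨a, ha, rfl⟩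
    obtain ⟨a', ha', h⟩ := this
    exact ⟨a' * b, mul_mem_wordBall ha' hb, by simpa using h⟩
  have hbd : ∀ m, (F m).ncard ≤ H.index := fun m => by
    rw [Subgroup.index_eq_card]
    simpa [Set.ncard_univ] using Set.ncard_le_ncard (Set.subset_univ (F m)) (Set.toFinite _)
  obtain ⟨n, hn⟩ := exists_mem_wordBall (X := X) (g := g) (by rw [hX]; trivial)
  have h1 := Nat.stabilises_of_monotone
    (fun m n hmn => Set.ncard_le_ncard (hF hmn) (Set.toFinite _)) hbd hstab
    (le_max_left H.index n)
  have h2 : F H.index = F (max H.index n) :=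
    Set.eq_of_subset_of_ncard_le (hF (le_max_left _ _)) h1.le (Set.toFinite _)
  have h3 : (g : G ⧸ H) ∈ F H.index := h2 ▸ hF (le_max_right _ _) ⟨g, hn, rfl⟩
  obtain ⟨r, hr, h⟩ := h3
  exact ⟨r, hr, h⟩

/-- A normal subgroup of finite index `d` is generated by its elements of length at most
`2 * d + 1`. -/
lemma closure_inter_wordBall_index (hX : Subgroup.closure (X : Set G) = ⊤) (H : Subgroup G)
    [H.Normal] [H.FiniteIndex] :
    Subgroup.closure ((H : Set G) ∩ wordBall X (2 * H.index + 1)) = H := by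
  set d := H.index
  set C := Subgroup.closure ((H : Set G) ∩ wordBall X (2 * d + 1))
  have hstep : ∀ r ∈ wordBall X d, ∀ x ∈ wordBall X 1, ∃ c ∈ C, ∃ r' ∈ wordBall X d,
      r * x = c * r' := by
    intro r hr x hx
    obtain ⟨r', hr', h⟩ := exists_mem_wordBall_index hX H (r * x)
    refine ⟨r * x * r'⁻¹, Subgroup.subset_closure ⟨?_, ?_⟩, r', hr', by group⟩
    · rw [SetLike.mem_coe, ← QuotientGroup.eq_one_iff]
      simp [h]
    · have := mul_mem_wordBall (mul_mem_wordBall hr hx) (inv_mem_wordBall hr')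
      exact wordBall_mono X (by omega) this
  have hall : ∀ n, ∀ g ∈ wordBall X n, ∃ c ∈ C, ∃ r ∈ wordBall X d, g = c * r := by
    intro n
    induction n with
    | zero => exact fun g hg => ⟨1, one_mem _, g, wordBall_mono X (Nat.zero_le _) hg, by simp⟩
    | succ n ih =>
      intro g hg
      obtain ⟨a, ha, x, hx, rfl⟩ := exists_mul_of_mem_wordBall_add hg
      obtain ⟨c, hc, r, hr, rfl⟩ := ih a ha
      obtain ⟨c', hc', r', hr', h⟩ := hstep r hr x hx
      exact ⟨c * c', mul_mem hc hc', r', hr', by rw [mul_assoc, h, mul_assoc]⟩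
  have hCH : C ≤ H := (Subgroup.closure_le _).2 fun x hx => hx.1
  refine le_antisymm hCH fun g hg => ?_
  obtain ⟨n, hn⟩ := exists_mem_wordBall (X := X) (g := g) (by rw [hX]; trivial)
  obtain ⟨c, hc, r, hr, rfl⟩ := hall n g hn
  refine mul_mem hc (Subgroup.subset_closure ⟨?_, wordBall_mono X (by omega) hr⟩)
  exact (Subgroup.mul_mem_cancel_left H (hCH hc)).1 hg

end WordBall

section FreePairs

variable {G : Type*} [Group G]

/-- The value in `G` of a binary word in the letters `a` (for `false`) and `b` (for `true`). -/
def binaryWord (a b : G) (l : List Bool) : G :=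
  (l.map fun e => if e then b else a).prod

/-- The pair `(a, b)` separates binary words of the same length. -/
def IsFreePair (a b : G) : Prop :=
  ∀ l l' : List Bool, l.length = l'.length → binaryWord a b l = binaryWord a b l' → l = l'

/-- For every radius `k` there is a finite generating set whose ball of radius `k` contains
no free pair. -/
def HasNoShortFreePairs (G : Type*) [Group G] : Prop :=
  ∀ k : ℕ, ∃ X : Finset G, Subgroup.closure (X : Set G) = ⊤ ∧
    ∀ a ∈ wordBall X k, ∀ b ∈ wordBall X k, ¬ IsFreePair a b

@[simp] lemma binaryWord_nil (a b : G) : binaryWord a b [] = 1 := rfl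

@[simp] lemma binaryWord_cons (a b : G) (e : Bool) (l : List Bool) :
    binaryWord a b (e :: l) = (if e then b else a) * binaryWord a b l := by
  simp [binaryWord]

lemma map_binaryWord {H : Type*} [Group H] (f : G →* H) (a b : G) (l : List Bool) :
    f (binaryWord a b l) = binaryWord (f a) (f b) l := by
  induction l with
  | nil => simp
  | cons e l ih => cases e <;> simp [ih]

lemma IsFreePair.of_map {H : Type*} [Group H] (f : G →* H) {a b : G}
    (h : IsFreePair (f a) (f b)) : IsFreePair a b := fun l l' hl hw =>
  h l l' hl (by rw [← map_binaryWord, ← map_binaryWord, hw])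

lemma IsFreePair.map {H : Type*} [Group H] {f : G →* H} (hf : Function.Injective f) {a b : G}
    (h : IsFreePair a b) : IsFreePair (f a) (f b) := fun l l' hl hw =>
  h l l' hl (hf (by rw [map_binaryWord, map_binaryWord, hw]))

lemma binaryWord_mem_wordBall {X : Finset G} {k : ℕ} {a b : G} (ha : a ∈ wordBall X k)
    (hb : b ∈ wordBall X k) (l : List Bool) : binaryWord a b l ∈ wordBall X (l.length * k) := by
  induction l with
  | nil => simpa using one_mem_wordBall X _
  | cons e l ih =>
    rw [binaryWord_cons, List.length_cons, Nat.succ_mul, Nat.add_comm]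
    refine mul_mem_wordBall ?_ ih
    cases e <;> simpa

lemma two_pow_le_growthFn {X : Finset G} {k : ℕ} {a b : G} (ha : a ∈ wordBall X k)
    (hb : b ∈ wordBall X k) (h : IsFreePair a b) (n : ℕ) : 2 ^ n ≤ growthFn X (n * k) := by
  have : Finite (wordBall X (n * k)) := wordBall_finite X _
  let φ : (Fin n → Bool) → wordBall X (n * k) := fun v =>
    ⟨binaryWord a b (List.ofFn v), by simpa using binaryWord_mem_wordBall ha hb (List.ofFn v)⟩
  have hφ : Function.Injective φ := fun v w hvw =>
    List.ofFn_injective (h _ _ (by simp) (congrArg Subtype.val hvw))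
  simpa [growthFn] using Nat.card_le_card_of_injective φ hφ

open Pointwise in
lemma growthFn_mul_le (X : Finset G) (m k : ℕ) : growthFn X (k * m) ≤ growthFn X m ^ k := by
  induction k with
  | zero =>
    have : wordBall X 0 ⊆ {1} := by
      rintro _ ⟨l, h1, -, rfl⟩
      simp [List.eq_nil_of_length_eq_zero (Nat.le_zero.1 h1)]
    simpa [growthFn] using Set.ncard_le_ncard this
  | succ k ih =>
    have hsub : wordBall X ((k + 1) * m) ⊆ wordBall X (k * m) * wordBall X m := by
      rw [Nat.succ_mul]
      intro g hg
      obtain ⟨a, ha, b, hb, rfl⟩ := exists_mul_of_mem_wordBall_add hg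
      exact Set.mul_mem_mul ha hb
    calc growthFn X ((k + 1) * m)
        ≤ Nat.card (wordBall X (k * m) * wordBall X m : Set G) :=
          Set.ncard_le_ncard hsub ((wordBall_finite X _).mul (wordBall_finite X _))
      _ ≤ growthFn X (k * m) * growthFn X m := Set.natCard_mul_le
      _ ≤ growthFn X m ^ (k + 1) := by rw [pow_succ]; gcongr

lemma le_growthRateX_of_isFreePair {X : Finset G} {k : ℕ} (hk : k ≠ 0) {a b : G}
    (ha : a ∈ wordBall X k) (hb : b ∈ wordBall X k) (h : IsFreePair a b) :
    (2 : ℝ) ^ ((1 : ℝ) / k) ≤ growthRateX X := by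
  refine le_ciInf fun n => ?_
  have h1 : 2 ^ (n + 1) ≤ growthFn X (n + 1) ^ k := by
    refine (two_pow_le_growthFn ha hb h (n + 1)).trans ?_
    rw [Nat.mul_comm]
    exact growthFn_mul_le X (n + 1) k
  have h2 : (2 : ℝ) ^ (n + 1) ≤ (growthFn X (n + 1) : ℝ) ^ k := by exact_mod_cast h1
  have h3 := Real.rpow_le_rpow (by positivity) h2
    (show (0 : ℝ) ≤ 1 / ((n + 1 : ℕ) * k) by positivity)
  have hk' : (k : ℝ) ≠ 0 := by exact_mod_cast hk
  have hn' : ((n + 1 : ℕ) : ℝ) ≠ 0 := by positivity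
  rw [← Real.rpow_natCast, ← Real.rpow_natCast, ← Real.rpow_mul (by norm_num),
    ← Real.rpow_mul (by positivity)] at h3
  have e1 : ((n + 1 : ℕ) : ℝ) * (1 / (((n + 1 : ℕ) : ℝ) * k)) = 1 / k := by field_simp
  have e2 : (k : ℝ) * (1 / (((n + 1 : ℕ) : ℝ) * k)) = 1 / ((n : ℝ) + 1) := by
    rw [Nat.cast_succ] at hn' ⊢
    field_simp
  rwa [e1, e2] at h3

theorem hasNoShortFreePairs_of_minGrowthRate_eq_one (hω : minGrowthRate G = 1) :
    HasNoShortFreePairs G := by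
  intro k
  by_contra! hcon
  have hne : {r : ℝ | ∃ X : Finset G, Subgroup.closure (X : Set G) = ⊤ ∧
      r = growthRateX X}.Nonempty := by
    by_contra hne
    rw [Set.not_nonempty_iff_eq_empty] at hne
    simp [minGrowthRate, hne] at hω
  have : (2 : ℝ) ^ ((1 : ℝ) / (k + 1 : ℕ)) ≤ minGrowthRate G := by
    refine le_csInf hne ?_
    rintro _ ⟨X, hX, rfl⟩
    obtain ⟨a, ha, b, hb, hab⟩ := hcon X hX
    exact le_growthRateX_of_isFreePair (Nat.succ_ne_zero k)
      (wordBall_mono X (Nat.le_succ k) ha) (wordBall_mono X (Nat.le_succ k) hb) hab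
  rw [hω] at this
  exact absurd this (not_le.2 (Real.one_lt_rpow (by norm_num) (by positivity)))

theorem HasNoShortFreePairs.of_surjective {H : Type*} [Group H] (hG : HasNoShortFreePairs G)
    {f : G →* H} (hf : Function.Surjective f) : HasNoShortFreePairs H := by
  classical
  intro k
  obtain ⟨X, hX, h⟩ := hG k
  refine ⟨X.image f, ?_, fun a ha b hb hab => ?_⟩
  · rw [Finset.coe_image, ← MonoidHom.map_closure, hX, ← MonoidHom.range_eq_map,
      MonoidHom.range_eq_top.2 hf]
  · obtain ⟨a, ha', rfl⟩ := exists_mem_wordBall_of_mem_wordBall_image f ha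
    obtain ⟨b, hb', rfl⟩ := exists_mem_wordBall_of_mem_wordBall_image f hb
    exact h a ha' b hb' (hab.of_map f)

theorem HasNoShortFreePairs.subgroup (hG : HasNoShortFreePairs G) (H : Subgroup G) [H.Normal]
    [H.FiniteIndex] : HasNoShortFreePairs H := by
  intro k
  obtain ⟨X, hX, h⟩ := hG (k * (2 * H.index + 1))
  have hfin : ((↑) ⁻¹' wordBall X (2 * H.index + 1) : Set H).Finite :=
    (wordBall_finite X _).preimage Subtype.val_injective.injOn
  have hmem : ∀ y ∈ hfin.toFinset, H.subtype y ∈ wordBall X (2 * H.index + 1) :=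
    fun y hy => by simpa using hy
  refine ⟨hfin.toFinset, ?_, fun a ha b hb hab => ?_⟩
  · have h1 : Subgroup.map H.subtype (Subgroup.closure (hfin.toFinset : Set H)) =
        Subgroup.map H.subtype ⊤ := by
      rw [MonoidHom.map_closure, ← MonoidHom.range_eq_map, Subgroup.range_subtype]
      conv_rhs => rw [← closure_inter_wordBall_index hX H]
      congr 1
      ext x
      simp [and_comm]
    exact Subgroup.map_injective H.subtype_injective h1
  · exact h _ (map_mem_wordBall_of_forall_mem H.subtype hmem ha) _
      (map_mem_wordBall_of_forall_mem H.subtype hmem hb) (hab.map H.subtype_injective)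

end FreePairs

section ConjClosure

variable {G : Type*} [Group G]

lemma Subgroup.conj_mem_of_mem_normalizer {T : Subgroup G} {g t : G}
    (hg : g ∈ Subgroup.normalizer (T : Set G)) (ht : t ∈ T) : g * t * g⁻¹ ∈ T :=
  (Subgroup.mem_normalizer_iff.1 hg t).1 ht

lemma Subgroup.le_normalizer_of_conj_mem {B T : Subgroup G}
    (h : ∀ b ∈ B, ∀ t ∈ T, b * t * b⁻¹ ∈ T) : B ≤ Subgroup.normalizer (T : Set G) := by
  intro b hb
  refine Subgroup.mem_normalizer_iff.2 fun t => ⟨h b hb t, fun ht => ?_⟩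
  simpa [mul_assoc] using h b⁻¹ (inv_mem hb) _ ht

lemma Subgroup.FG.map_hom {H : Type*} [Group H] {K : Subgroup G} (hK : K.FG) (f : G →* H) :
    (K.map f).FG := by
  obtain ⟨S, rfl, hS⟩ := (Subgroup.fg_iff K).1 hK
  exact (Subgroup.fg_iff _).2 ⟨f '' S, (MonoidHom.map_closure f S).symm, hS.image f⟩

/-- If `(a, c * a)` is not a free pair, then `c` lies in the subgroup generated by finitely many
of its conjugates by positive powers of `a`. -/
lemma exists_mem_closure_conj_of_not_isFreePair {a c : G} (h : ¬ IsFreePair a (c * a)) :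
    ∃ n : ℕ, c ∈ Subgroup.closure {g | ∃ i, 1 ≤ i ∧ i ≤ n ∧ g = a ^ i * c * (a ^ i)⁻¹} := by
  set S : ℕ → Subgroup G := fun n =>
    Subgroup.closure {g | ∃ i, 1 ≤ i ∧ i ≤ n ∧ g = a ^ i * c * (a ^ i)⁻¹} with hS
  have hconj : ∀ n, ∀ g ∈ S n, a * g * a⁻¹ ∈ S (n + 1) := by
    intro n g hg
    have : S n ≤ (S (n + 1)).comap (MulAut.conj a).toMonoidHom := by
      refine (Subgroup.closure_le _).2 ?_
      rintro _ ⟨i, h1, h2, rfl⟩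
      refine Subgroup.subset_closure ⟨i + 1, by omega, by omega, ?_⟩
      simp [pow_succ', mul_assoc]
    exact this hg
  have hword : ∀ u : List Bool,
      a * binaryWord a (c * a) u * (a ^ (u.length + 1))⁻¹ ∈ S u.length := by
    intro u
    induction u with
    | nil => simp
    | cons e u ih =>
      have h1 := hconj _ _ ih
      have h2 : a * c * a⁻¹ ∈ S (u.length + 1) :=
        Subgroup.subset_closure ⟨1, le_rfl, by omega, by simp⟩
      cases e
      · simpa [pow_succ' a (u.length + 1), mul_assoc] using h1
      · simpa [pow_succ' a (u.length + 1), mul_assoc] using mul_mem h2 h1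
  suffices H : ∀ l l' : List Bool, l.length = l'.length →
      binaryWord a (c * a) l = binaryWord a (c * a) l' → l ≠ l' → ∃ n, c ∈ S n by
    simp only [IsFreePair, not_forall] at h
    obtain ⟨l, l', h1, h2, h3⟩ := h
    exact H l l' h1 h2 h3
  have key : ∀ u u' : List Bool, u.length = u'.length →
      a * binaryWord a (c * a) u = c * a * binaryWord a (c * a) u' → ∃ n, c ∈ S n := by
    intro u u' hl hw
    refine ⟨u.length, ?_⟩
    have h1 := hword u
    have h2 := hword u'
    rw [← hl] at h2
    convert mul_mem h1 (inv_mem h2) using 1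
    rw [hw]
    group
  intro l
  induction l with
  | nil =>
    intro l' hl _ hne
    exact absurd (List.eq_nil_of_length_eq_zero hl.symm).symm hne
  | cons e u ih =>
    rintro (_ | ⟨e', u'⟩) hl hw hne
    · simp at hl
    · have hl' : u.length = u'.length := by simpa using hl
      rw [binaryWord_cons, binaryWord_cons] at hw
      cases e <;> cases e'
      · exact ih u' hl' (by simpa using hw) (by simpa using hne)
      · exact key u u' hl' (by simpa using hw)
      · exact key u' u hl'.symm (by simpa using hw.symm)
      · exact ih u' hl' (by simpa using hw) (by simpa using hne)

/-- The subgroup generated by the conjugates of elements of `S` by elements of `B`. -/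
def conjClosure (B : Subgroup G) (S : Set G) : Subgroup G :=
  Subgroup.closure {g | ∃ b ∈ B, ∃ s ∈ S, g = b * s * b⁻¹}

lemma subset_conjClosure (B : Subgroup G) (S : Set G) : S ⊆ conjClosure B S :=
  fun s hs => Subgroup.subset_closure ⟨1, one_mem B, s, hs, by simp⟩

lemma conjClosure_le {B T : Subgroup G} {S : Set G}
    (hB : B ≤ Subgroup.normalizer (T : Set G)) (hS : S ⊆ T) : conjClosure B S ≤ T := by
  refine (Subgroup.closure_le _).2 ?_
  rintro _ ⟨b, hb, s, hs, rfl⟩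
  exact Subgroup.conj_mem_of_mem_normalizer (hB hb) (hS hs)

lemma le_normalizer_conjClosure (B : Subgroup G) (S : Set G) :
    B ≤ Subgroup.normalizer (conjClosure B S : Set G) := by
  refine Subgroup.le_normalizer_of_conj_mem fun b hb t ht => ?_
  have : conjClosure B S ≤ (conjClosure B S).comap (MulAut.conj b).toMonoidHom := by
    refine (Subgroup.closure_le _).2 ?_
    rintro _ ⟨b', hb', s, hs, rfl⟩
    exact Subgroup.subset_closure ⟨b * b', mul_mem hb hb', s, hs, by simp [mul_assoc]⟩
  exact this ht

lemma conjClosure_mono {B B' : Subgroup G} {S S' : Set G} (hB : B ≤ B') (hS : S ⊆ S') :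
    conjClosure B S ≤ conjClosure B' S' := by
  refine Subgroup.closure_mono ?_
  rintro _ ⟨b, hb, s, hs, rfl⟩
  exact ⟨b, hB hb, s, hS hs, rfl⟩

theorem fg_conjClosure_sup_zpowers {B : Subgroup G} {C : Set G} (hfin : C.Finite) {z : G}
    (hC : (conjClosure B C).FG)
    (h1 : ∀ b ∈ B, z * b * z⁻¹ ∈ Subgroup.closure (B ∪ C))
    (h2 : ∀ b ∈ B, z⁻¹ * b * z ∈ Subgroup.closure (B ∪ C))
    (hm : ∀ c ∈ C, ¬ IsFreePair z (c * z)) (hm' : ∀ c ∈ C, ¬ IsFreePair z⁻¹ (c * z⁻¹)) :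
    (conjClosure (B ⊔ Subgroup.zpowers z) C).FG := by
  have hbound : ∀ w : G, (∀ c ∈ C, ¬ IsFreePair w (c * w)) → ∃ n : ℕ, ∀ c ∈ C,
      c ∈ Subgroup.closure {g | ∃ i, 1 ≤ i ∧ i ≤ n ∧ g = w ^ i * c * (w ^ i)⁻¹} := by
    intro w hw
    choose! f hf using fun c hc => exists_mem_closure_conj_of_not_isFreePair (hw c hc)
    obtain ⟨n, hn⟩ := (hfin.image f).bddAbove
    refine ⟨n, fun c hc => Subgroup.closure_mono ?_ (hf c hc)⟩
    rintro _ ⟨i, hi1, hi2, rfl⟩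
    exact ⟨i, hi1, hi2.trans (hn ⟨c, hc, rfl⟩), rfl⟩
  obtain ⟨n₁, hn₁⟩ := hbound z hm
  obtain ⟨n₂, hn₂⟩ := hbound z⁻¹ hm'
  set n := max n₁ n₂
  let S : ℕ → Set G := fun q => {g | ∃ i ≤ q, ∃ c ∈ C, g = z ^ i * c * (z ^ i)⁻¹}
  let T : ℕ → Subgroup G := fun q => conjClosure B (S q)
  have hST : ∀ q i, i ≤ q → ∀ c ∈ C, z ^ i * c * (z ^ i)⁻¹ ∈ T q := fun q i hi c hc =>
    subset_conjClosure B (S q) ⟨i, hi, c, hc, rfl⟩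
  have hCT : ∀ q, C ⊆ T q := fun q c hc => by simpa using hST q 0 (Nat.zero_le q) c hc
  have hnorm : ∀ q, Subgroup.closure (B ∪ C) ≤ Subgroup.normalizer (T q : Set G) := fun q =>
    (Subgroup.closure_le _).2 (Set.union_subset (le_normalizer_conjClosure B (S q))
      ((hCT q).trans Subgroup.le_normalizer))
  have hup : ∀ q, (T q).map (MulAut.conj z).toMonoidHom ≤ T (q + 1) := by
    intro q
    rw [Subgroup.map_le_iff_le_comap]
    refine (Subgroup.closure_le _).2 ?_
    rintro _ ⟨b, hb, _, ⟨i, hi, c, hc, rfl⟩, rfl⟩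
    have := Subgroup.conj_mem_of_mem_normalizer (hnorm (q + 1) (h1 b hb))
      (hST (q + 1) (i + 1) (by omega) c hc)
    simpa [pow_succ', mul_assoc] using this
  have hdown : ∀ q, T (q + 1) ≤ T q ⊔ (T q).map (MulAut.conj z).toMonoidHom := by
    intro q
    refine conjClosure_le (Subgroup.le_normalizer_of_conj_mem fun b hb t ht => ?_) ?_
    · have : T q ⊔ (T q).map (MulAut.conj z).toMonoidHom ≤
          (T q ⊔ (T q).map (MulAut.conj z).toMonoidHom).comap (MulAut.conj b).toMonoidHom := by
        refine sup_le (fun t ht => ?_) ?_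
        · exact (le_sup_left : T q ≤ _) (Subgroup.conj_mem_of_mem_normalizer
            (le_normalizer_conjClosure B (S q) hb) ht)
        · rintro _ ⟨t, ht, rfl⟩
          refine (le_sup_right : (T q).map (MulAut.conj z).toMonoidHom ≤ _) ⟨_,
            Subgroup.conj_mem_of_mem_normalizer (hnorm q (h2 b hb)) ht, ?_⟩
          simp [mul_assoc]
      exact this ht
    · rintro _ ⟨i, hi, c, hc, rfl⟩
      rcases i with _ | i
      · exact (le_sup_left : T q ≤ _) (hST q 0 (Nat.zero_le q) c hc)
      · refine (le_sup_right : (T q).map (MulAut.conj z).toMonoidHom ≤ _)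
          ⟨_, hST q i (by omega) c hc, ?_⟩
        simp [pow_succ', mul_assoc]
  have hfg : ∀ q, (T q).FG := by
    intro q
    induction q with
    | zero => simpa [T, S] using hC
    | succ q ih =>
      have : T (q + 1) = T q ⊔ (T q).map (MulAut.conj z).toMonoidHom := by
        refine le_antisymm (hdown q) (sup_le (conjClosure_mono le_rfl ?_) (hup q))
        rintro _ ⟨i, hi, c, hc, rfl⟩
        exact ⟨i, by omega, c, hc, rfl⟩
      rw [this]
      exact ih.sup (ih.map_hom _)
  have hstable : T (n + 1) ≤ T n := by
    refine conjClosure_le (le_normalizer_conjClosure B (S n)) ?_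
    rintro _ ⟨i, hi, c, hc, rfl⟩
    rcases Nat.lt_or_ge n i with hi' | hi'
    · obtain rfl : i = n + 1 := by omega
      have : Subgroup.closure {g | ∃ i, 1 ≤ i ∧ i ≤ n₂ ∧ g = z⁻¹ ^ i * c * (z⁻¹ ^ i)⁻¹} ≤
          (T n).comap (MulAut.conj (z ^ (n + 1))).toMonoidHom := by
        refine (Subgroup.closure_le _).2 ?_
        rintro _ ⟨j, hj1, hj2, rfl⟩
        have hj3 : j ≤ n + 1 := by omega
        have hj := hST n (n + 1 - j) (by omega) c hc
        rw [pow_sub z hj3] at hj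
        simpa [mul_assoc, -map_pow] using hj
      exact this (hn₂ c hc)
    · exact hST n i hi' c hc
  have hz : z ∈ Subgroup.normalizer (T n : Set G) := by
    refine Subgroup.mem_normalizer_iff.2 fun t => ⟨fun ht => hstable (hup n ⟨t, ht, rfl⟩), ?_⟩
    intro ht
    have : T n ≤ (T n).comap (MulAut.conj z⁻¹).toMonoidHom := by
      refine (Subgroup.closure_le _).2 ?_
      rintro _ ⟨b, hb, _, ⟨i, hi, c, hc, rfl⟩, rfl⟩
      have hs : z⁻¹ * (z ^ i * c * (z ^ i)⁻¹) * z ∈ T n := by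
        rcases i with _ | i
        · have : Subgroup.closure {g | ∃ i, 1 ≤ i ∧ i ≤ n₁ ∧ g = z ^ i * c * (z ^ i)⁻¹} ≤
              (T n).comap (MulAut.conj z⁻¹).toMonoidHom := by
            refine (Subgroup.closure_le _).2 ?_
            rintro _ ⟨j, hj1, hj2, rfl⟩
            obtain ⟨j, rfl⟩ : ∃ k, j = k + 1 := ⟨j - 1, by omega⟩
            simpa [pow_succ', mul_assoc] using hST n j (by omega) c hc
          simpa using this (hn₁ c hc)
        · simpa [pow_succ', mul_assoc] using hST n i (by omega) c hc
      have := Subgroup.conj_mem_of_mem_normalizer (hnorm n (h2 b hb)) hs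
      simpa [mul_assoc] using this
    simpa [mul_assoc] using this ht
  have heq : conjClosure (B ⊔ Subgroup.zpowers z) C = T n := by
    refine le_antisymm (conjClosure_le (sup_le (le_normalizer_conjClosure B (S n)) ?_) (hCT n))
      (conjClosure_le ?_ ?_)
    · rwa [Subgroup.zpowers_le]
    · exact le_sup_left.trans (le_normalizer_conjClosure _ C)
    · rintro _ ⟨i, -, c, hc, rfl⟩
      refine Subgroup.subset_closure ⟨z ^ i, ?_, c, hc, rfl⟩
      exact (le_sup_right : Subgroup.zpowers z ≤ _) (Subgroup.npow_mem_zpowers z i)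
  rw [heq]
  exact hfg n

end ConjClosure

section CommutatorOver

open scoped commutatorElement

variable {G : Type*} [Group G] {X : Finset G}

/-- Iterated commutators in the letters of `X ∪ X⁻¹`; `IsCommutatorOver X w g` says that `g` is
such a commutator of depth `w`, whose last step brackets it with one of smaller depth. -/
inductive IsCommutatorOver (X : Finset G) : ℕ → G → Prop
  | letter {x : G} (hx : x ∈ X ∨ x⁻¹ ∈ X) : IsCommutatorOver X 0 x
  | left {i j : ℕ} {x y : G} (hij : i ≤ j) (hx : IsCommutatorOver X i x)
      (hy : IsCommutatorOver X j y) : IsCommutatorOver X (j + 1) ⁅x, y⁆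
  | right {i j : ℕ} {x y : G} (hij : i ≤ j) (hx : IsCommutatorOver X i x)
      (hy : IsCommutatorOver X j y) : IsCommutatorOver X (j + 1) ⁅y, x⁆

namespace IsCommutatorOver

lemma inv {j : ℕ} {x : G} (hx : IsCommutatorOver X j x) : IsCommutatorOver X j x⁻¹ := by
  cases hx with
  | letter h => exact .letter (by simpa using h.symm)
  | left hij hx hy => rw [commutatorElement_inv]; exact .right hij hx hy
  | right hij hx hy => rw [commutatorElement_inv]; exact .left hij hx hy

lemma mem_wordBall {j : ℕ} {x : G} (hx : IsCommutatorOver X j x) : x ∈ wordBall X (4 ^ j) := by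
  have key : ∀ {i j : ℕ} {x y : G}, x ∈ wordBall X (4 ^ i) → y ∈ wordBall X (4 ^ j) →
      i ≤ j → ⁅x, y⁆ ∈ wordBall X (4 ^ (j + 1)) ∧ ⁅y, x⁆ ∈ wordBall X (4 ^ (j + 1)) := by
    intro i j x y hx hy hij
    replace hx := wordBall_mono X (Nat.pow_le_pow_right (by norm_num) hij : 4 ^ i ≤ 4 ^ j) hx
    rw [show 4 ^ (j + 1) = 4 ^ j + 4 ^ j + 4 ^ j + 4 ^ j by ring]
    exact ⟨mul_mem_wordBall (mul_mem_wordBall (mul_mem_wordBall hx hy) (inv_mem_wordBall hx))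
      (inv_mem_wordBall hy), mul_mem_wordBall (mul_mem_wordBall (mul_mem_wordBall hy hx)
      (inv_mem_wordBall hy)) (inv_mem_wordBall hx)⟩
  induction hx with
  | letter h => exact mem_wordBall_one h
  | left hij _ _ ihx ihy => exact (key ihx ihy hij).1
  | right hij _ _ ihx ihy => exact (key ihx ihy hij).2

lemma setOf_finite (X : Finset G) (j : ℕ) : {x | IsCommutatorOver X j x}.Finite :=
  (wordBall_finite X (4 ^ j)).subset fun _ hx => hx.mem_wordBall

lemma mem_lowerCentralSeries {j : ℕ} {x : G} (hx : IsCommutatorOver X j x) :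
    x ∈ (⊤ : Subgroup G).lowerCentralSeries j := by
  induction hx with
  | letter h => trivial
  | left hij _ _ ihx ihy =>
    rw [← commutatorElement_inv]
    exact inv_mem (Subgroup.commutator_mem_commutator ihy (Subgroup.mem_top _))
  | right hij _ _ ihx ihy => exact Subgroup.commutator_mem_commutator ihy (Subgroup.mem_top _)

/-- Any conjugation-stable build-up of the group from commutators of decreasing depth. -/
theorem induction_top (hX : Subgroup.closure (X : Set G) = ⊤) {s : ℕ} (hs : 0 < s)
    (P : Subgroup G → Prop) (bot : P ⊥)
    (step : ∀ (B : Subgroup G) (z : G) (j : ℕ), j < s → IsCommutatorOver X j z → P B →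
      (∀ b ∈ B, z * b * z⁻¹ ∈ Subgroup.closure (B ∪ {c | IsCommutatorOver X s c})) →
      (∀ b ∈ B, z⁻¹ * b * z ∈ Subgroup.closure (B ∪ {c | IsCommutatorOver X s c})) →
      P (B ⊔ Subgroup.zpowers z)) : P ⊤ := by
  set U : ℕ → Set G := fun j => {g | ∃ w, j ≤ w ∧ w < s ∧ IsCommutatorOver X w g} with hU
  have hstep : ∀ j < s, P (Subgroup.closure (U (j + 1))) → P (Subgroup.closure (U j)) := by
    intro j hj h0
    have : ∀ F : Set G, F.Finite → F ⊆ {x | IsCommutatorOver X j x} →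
        P (Subgroup.closure (F ∪ U (j + 1))) := by
      intro F hF
      induction F, hF using Set.Finite.induction_on with
      | empty => simpa using h0
      | @insert z F hzF hF ih =>
        intro hsub
        have hz : IsCommutatorOver X j z := hsub (Set.mem_insert _ _)
        have hFsub : F ⊆ {x | IsCommutatorOver X j x} := (Set.subset_insert _ _).trans hsub
        set B := Subgroup.closure (F ∪ U (j + 1)) with hB
        have hconj : ∀ z, IsCommutatorOver X j z → ∀ b ∈ B, z * b * z⁻¹ ∈
            Subgroup.closure (B ∪ {c | IsCommutatorOver X s c}) := by
          intro z hz b hb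
          have : B ≤ (Subgroup.closure (B ∪ {c | IsCommutatorOver X s c})).comap
              (MulAut.conj z).toMonoidHom := by
            refine (Subgroup.closure_le _).2 fun y hy => ?_
            have hyB : y ∈ B := Subgroup.subset_closure hy
            obtain ⟨w, hjw, hws, hyw⟩ : ∃ w, j ≤ w ∧ w < s ∧ IsCommutatorOver X w y := by
              rcases hy with hy | ⟨w, h1, h2, h3⟩
              · exact ⟨j, le_rfl, hj, hFsub hy⟩
              · exact ⟨w, by omega, h2, h3⟩
            have h4 : ⁅z, y⁆ ∈ Subgroup.closure (B ∪ {c | IsCommutatorOver X s c}) := by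
              refine Subgroup.subset_closure ?_
              rcases Nat.lt_or_ge (w + 1) s with h | h
              · exact .inl (Subgroup.subset_closure
                  (.inr ⟨w + 1, by omega, h, .left hjw hz hyw⟩))
              · obtain rfl : s = w + 1 := by omega
                exact .inr (.left hjw hz hyw)
            have := mul_mem h4 (Subgroup.subset_closure (.inl hyB))
            simpa [commutatorElement_def] using this
          exact this hb
        have heq : Subgroup.closure (insert z F ∪ U (j + 1)) = B ⊔ Subgroup.zpowers z := by
          rw [Set.insert_union, Set.insert_eq, Subgroup.closure_union, sup_comm,
            Subgroup.zpowers_eq_closure]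
        rw [heq]
        exact step B z j hj hz (ih hFsub) (hconj z hz) (by simpa using hconj z⁻¹ hz.inv)
    have hfin := this _ (setOf_finite X j) le_rfl
    convert hfin using 2
    ext g
    constructor
    · rintro ⟨w, h1, h2, h3⟩
      rcases h1.eq_or_lt with rfl | h1
      · exact .inl h3
      · exact .inr ⟨w, h1, h2, h3⟩
    · rintro (h | ⟨w, h1, h2, h3⟩)
      · exact ⟨j, le_rfl, hj, h⟩
      · exact ⟨w, by omega, h2, h3⟩
  have hall : ∀ i ≤ s, P (Subgroup.closure (U (s - i))) := by
    intro i
    induction i with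
    | zero =>
      intro _
      have : U (s - 0) = ∅ := by
        ext g
        simp [hU]
        omega
      rw [this, Subgroup.closure_empty]
      exact bot
    | succ i ih =>
      intro hi
      refine hstep _ (by omega) ?_
      rw [show s - (i + 1) + 1 = s - i by omega]
      exact ih (by omega)
  have h := hall s le_rfl
  have htop : Subgroup.closure (U 0) = ⊤ := top_le_iff.1 <| hX.ge.trans <|
    Subgroup.closure_mono fun x hx => ⟨0, le_rfl, hs, .letter (.inl hx)⟩
  rwa [Nat.sub_self, htop] at h

end IsCommutatorOver

lemma lowerCentralSeries_eq_normalClosure (hX : Subgroup.closure (X : Set G) = ⊤) (s : ℕ) :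
    (⊤ : Subgroup G).lowerCentralSeries s =
      Subgroup.normalClosure {c | IsCommutatorOver X s c} := by
  refine le_antisymm ?_
    (Subgroup.normalClosure_le_normal fun x hx => IsCommutatorOver.mem_lowerCentralSeries hx)
  induction s with
  | zero =>
    refine le_trans (le_top.trans hX.ge) (Subgroup.closure_le_normalClosure.trans' ?_)
    exact Subgroup.closure_mono fun x hx => .letter (.inl hx)
  | succ s ih =>
    set R := Subgroup.normalClosure {c | IsCommutatorOver X (s + 1) c}
    refine (Subgroup.commutator_mono ih le_rfl).trans ?_
    have hcent : ∀ y, IsCommutatorOver X s y → (y : G ⧸ R) ∈ Subgroup.center (G ⧸ R) := by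
      intro y hy
      have : (⊤ : Subgroup G) ≤
          (Subgroup.centralizer {(y : G ⧸ R)}).comap (QuotientGroup.mk' R) := by
        rw [← hX]
        refine (Subgroup.closure_le _).2 fun x hx => ?_
        have hc : ⁅x, y⁆ ∈ R :=
          Subgroup.subset_normalClosure (.left (Nat.zero_le s) (.letter (.inl hx)) hy)
        rw [SetLike.mem_coe, Subgroup.mem_comap, Subgroup.mem_centralizer_singleton_iff,
          ← commutatorElement_eq_one_iff_mul_comm]
        exact (QuotientGroup.eq_one_iff _).2 hc
      refine Subgroup.mem_center_iff.2 fun g => ?_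
      obtain ⟨g, rfl⟩ := QuotientGroup.mk_surjective g
      exact (Subgroup.mem_centralizer_singleton_iff.1 (this (Subgroup.mem_top g)))
    have hle : Subgroup.normalClosure {c | IsCommutatorOver X s c} ≤
        (Subgroup.center (G ⧸ R)).comap (QuotientGroup.mk' R) :=
      Subgroup.normalClosure_le_normal fun y hy => hcent y hy
    refine Subgroup.commutator_le.2 fun a ha b _ => ?_
    have := Subgroup.mem_center_iff.1 (hle ha) (b : G ⧸ R)
    rw [← QuotientGroup.eq_one_iff]
    exact commutatorElement_eq_one_iff_mul_comm.2 this.symm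

lemma conjClosure_top (S : Set G) : conjClosure ⊤ S = Subgroup.normalClosure S := by
  refine le_antisymm (conjClosure_le ?_ Subgroup.subset_normalClosure) ?_
  · rw [Subgroup.normalizer_eq_top]
  · have : (conjClosure ⊤ S).Normal :=
      Subgroup.normalizer_eq_top_iff.1 (top_le_iff.1 (le_normalizer_conjClosure ⊤ S))
    exact Subgroup.normalClosure_le_normal (subset_conjClosure ⊤ S)

/-- All terms of the lower central series are finitely generated. -/
theorem HasNoShortFreePairs.fg_lowerCentralSeries (hG : HasNoShortFreePairs G) (s : ℕ) :
    ((⊤ : Subgroup G).lowerCentralSeries s).FG := by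
  obtain ⟨X, hX, hfree⟩ := hG (2 * 4 ^ s)
  rcases Nat.eq_zero_or_pos s with rfl | hs
  · exact (Subgroup.fg_iff _).2 ⟨X, hX, X.finite_toSet⟩
  rw [lowerCentralSeries_eq_normalClosure hX s, ← conjClosure_top]
  have hfin := IsCommutatorOver.setOf_finite X s
  refine IsCommutatorOver.induction_top hX hs
    (fun B => (conjClosure B {c | IsCommutatorOver X s c}).FG) ?_ ?_
  · refine (Subgroup.fg_iff _).2 ⟨_, rfl, hfin.subset ?_⟩
    rintro _ ⟨b, hb, c, hc, rfl⟩
    simpa [Subgroup.mem_bot.1 hb] using hc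
  · intro B z j hj hz hB h1 h2
    have hle : 4 ^ j ≤ 4 ^ s := Nat.pow_le_pow_right (by norm_num) hj.le
    have hno : ∀ z, IsCommutatorOver X j z → ∀ c, IsCommutatorOver X s c →
        ¬ IsFreePair z (c * z) := fun z hz c hc =>
      hfree _ (wordBall_mono X (by omega) hz.mem_wordBall) _
        (wordBall_mono X (by omega) (mul_mem_wordBall hc.mem_wordBall hz.mem_wordBall))
    exact fg_conjClosure_sup_zpowers hfin hB h1 h2 (hno z hz) (hno z⁻¹ hz.inv)

end CommutatorOver

section Eigenvalues

open Polynomial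

/-- Kronecker's theorem with a gap: if all complex roots of a monic integral polynomial of degree
`n` are close enough to the unit disc, then its nonzero roots are roots of unity. -/
lemma exists_forall_root_pow_eq_one (n : ℕ) : ∃ k : ℕ, ∀ p : ℤ[X], p.Monic → p.natDegree = n →
    (∀ μ ∈ p.aroots ℂ, ‖μ‖ ^ k < 2) → ∀ μ ∈ p.aroots ℂ, μ ≠ 0 → ∃ N, 0 < N ∧ μ ^ N = 1 := by
  let M : ℤ[X] → ℝ := fun p => (p.map (Int.castRingHom ℂ)).mahlerMeasure
  have hex : ∀ p, ∃ k : ℕ, 1 < M p → 2 ^ n < M p ^ k := fun p => by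
    by_cases h : 1 < M p
    · obtain ⟨k, hk⟩ := pow_unbounded_of_one_lt (2 ^ n) h
      exact ⟨k, fun _ => hk⟩
    · exact ⟨0, fun h' => absurd h' h⟩
  choose K hK using hex
  obtain ⟨k, hk⟩ := ((finite_mahlerMeasure_le n (2 ^ n)).image K).bddAbove
  refine ⟨k + 1, fun p hp hn hroots μ hμ hμ0 => ?_⟩
  have hprod : M p = ((p.aroots ℂ).map fun a => max 1 ‖a‖).prod := by
    simp [M, mahlerMeasure_eq_leadingCoeff_mul_prod_roots, (hp.map _).leadingCoeff, aroots]
  have hone : 1 ≤ M p := by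
    rw [hprod]
    refine Multiset.one_le_prod fun x hx => ?_
    obtain ⟨a, -, rfl⟩ := Multiset.mem_map.1 hx
    exact le_max_left _ _
  have hpow : M p ^ (k + 1) ≤ 2 ^ n := by
    rw [hprod, ← Multiset.prod_map_pow]
    have hcard : Multiset.card (p.aroots ℂ) ≤ n := by
      rw [← hn, ← hp.natDegree_map (algebraMap ℤ ℂ)]
      exact card_roots' _
    refine le_trans ?_ (pow_le_pow_right₀ (by norm_num : (1 : ℝ) ≤ 2) hcard)
    rw [← Multiset.prod_replicate, ← Multiset.map_const']
    refine Multiset.prod_map_le_prod_map₀ _ _ (fun a _ => by positivity) fun a ha => ?_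
    rcases max_choice 1 ‖a‖ with h | h <;> rw [h]
    · norm_num
    · exact (hroots a ha).le
  have hle : M p ≤ ((2 ^ n : NNReal) : ℝ) := by
    push_cast
    exact (le_self_pow₀ hone (Nat.succ_ne_zero k)).trans hpow
  have hM : M p = 1 := by
    refine le_antisymm (not_lt.1 fun h => ?_) hone
    have h1 : K p ≤ k := hk ⟨p, ⟨hn.le, hle⟩, rfl⟩
    have h2 := (hK p h).trans_le (pow_le_pow_right₀ hone (h1.trans (Nat.le_succ k)))
    exact absurd hpow (not_le.2 h2)
  exact pow_eq_one_of_mahlerMeasure_eq_one hM hμ0 hμ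

variable {M : Type*} [AddCommGroup M] [Module.Free ℤ M] [Module.Finite ℤ M]

lemma exists_eigenfunctional (f : M →ₗ[ℤ] M) {μ : ℂ} (hμ : μ ∈ f.charpoly.aroots ℂ) :
    ∃ φ : M →ₗ[ℤ] ℂ, φ ≠ 0 ∧ ∀ x, φ (f x) = μ * φ x := by
  classical
  let b := Module.Free.chooseBasis ℤ M
  let A := (LinearMap.toMatrix b b f).map (algebraMap ℤ ℂ)
  have hdet : (Matrix.scalar _ μ - A).det = 0 := by
    rw [← Matrix.eval_charpoly]
    have : A.charpoly = f.charpoly.map (algebraMap ℤ ℂ) := by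
      rw [Matrix.charpoly_map, LinearMap.charpoly_toMatrix]
    rw [this]
    exact isRoot_of_mem_roots hμ
  obtain ⟨v, hv, hvA⟩ := Matrix.exists_vecMul_eq_zero_iff.2 hdet
  let φ : M →ₗ[ℤ] ℂ := b.constr ℤ v
  have hφ : ∀ i, φ (b i) = v i := fun i => b.constr_basis ℤ v i
  refine ⟨φ, fun h => hv (funext fun i => by rw [← hφ, h]; simp), fun x => ?_⟩
  have : φ ∘ₗ f = (LinearMap.mulLeft ℤ μ) ∘ₗ φ := by
    refine b.ext fun j => ?_
    have hj := congrFun hvA j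
    rw [Matrix.vecMul_sub] at hj
    have h1 : φ (f (b j)) = Matrix.vecMul v A j := by
      rw [← b.sum_repr (f (b j)), map_sum]
      simp [Matrix.vecMul, dotProduct, A, LinearMap.toMatrix_apply, hφ, mul_comm]
    simp only [Pi.sub_apply, Pi.zero_apply, sub_eq_zero] at hj
    simp only [LinearMap.comp_apply, h1, ← hj, LinearMap.mulLeft_apply, hφ]
    simp [Matrix.vecMul, dotProduct, Matrix.diagonal_apply, mul_comm]
  exact congrArg (fun g => g x) this

lemma exists_pow_sub_one_pow_eq_zero (f : M →ₗ[ℤ] M)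
    (h : ∀ μ ∈ f.charpoly.aroots ℂ, ∃ N, 0 < N ∧ μ ^ N = 1) :
    ∃ N n : ℕ, 0 < N ∧ (f ^ N - 1) ^ n = 0 := by
  have hN : ∀ t : Multiset ℂ, (∀ μ ∈ t, ∃ N, 0 < N ∧ μ ^ N = 1) →
      ∃ N, 0 < N ∧ ∀ μ ∈ t, μ ^ N = 1 := by
    intro t
    induction t using Multiset.induction_on with
    | empty => exact fun _ => ⟨1, one_pos, by simp⟩
    | cons a t ih =>
      intro ht
      obtain ⟨N, hN0, hN⟩ := ih fun μ hμ => ht μ (Multiset.mem_cons_of_mem hμ)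
      obtain ⟨N', hN0', hN'⟩ := ht a (Multiset.mem_cons_self a t)
      refine ⟨N * N', Nat.mul_pos hN0 hN0', fun μ hμ => ?_⟩
      rcases Multiset.mem_cons.1 hμ with rfl | hμ
      · rw [mul_comm, pow_mul, hN', one_pow]
      · rw [pow_mul, hN μ hμ, one_pow]
  obtain ⟨N, hN0, hN⟩ := hN _ h
  have hmonic := f.charpoly_monic
  have hdvd : f.charpoly ∣ (X ^ N - 1) ^ Multiset.card (f.charpoly.aroots ℂ) := by
    rw [← map_dvd_map (algebraMap ℤ ℂ) (algebraMap ℤ ℂ).injective_int hmonic]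
    have hs := (IsAlgClosed.splits (f.charpoly.map (algebraMap ℤ ℂ))).eq_prod_roots_of_monic
      (hmonic.map _)
    rw [hs]
    have : (map (algebraMap ℤ ℂ) ((X ^ N - 1) ^ Multiset.card (f.charpoly.aroots ℂ))) =
        ((f.charpoly.aroots ℂ).map fun _ => (X ^ N - 1 : ℂ[X])).prod := by
      simp
    rw [this]
    refine Multiset.prod_dvd_prod_of_dvd _ _ fun μ hμ => ?_
    rw [dvd_iff_isRoot]
    simp [hN μ hμ]
  refine ⟨N, Multiset.card (f.charpoly.aroots ℂ), hN0, ?_⟩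
  obtain ⟨q, hq⟩ := hdvd
  have := congrArg (aeval f) hq
  simpa [f.aeval_self_charpoly] using this

/-- The functionals `φ ∘ ρ g` with `g` short already separate as much as all of them. -/
lemma exists_mem_wordBall_map_ne_zero {G : Type*} [Group G] {X : Finset G}
    (hX : Subgroup.closure (X : Set G) = ⊤) (ρ : G →* Module.End ℤ M) (φ : M →ₗ[ℤ] ℂ) {y : M}
    {g : G} (hg : φ (ρ g y) ≠ 0) : ∃ r ∈ wordBall X (Module.finrank ℤ M), φ (ρ r y) ≠ 0 := by
  let F : ℕ → Submodule ℂ (M →ₗ[ℤ] ℂ) := fun n =>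
    Submodule.span ℂ ((fun x : G => φ ∘ₗ ρ x) '' wordBall X n)
  have hF : Monotone F := fun m n hmn => Submodule.span_mono (Set.image_mono (wordBall_mono X hmn))
  have hstab : ∀ m, Module.finrank ℂ (F m) = Module.finrank ℂ (F (m + 1)) →
      Module.finrank ℂ (F (m + 1)) = Module.finrank ℂ (F (m + 2)) := by
    intro m hm
    have hm' : F m = F (m + 1) := Submodule.eq_of_le_of_finrank_eq (hF (Nat.le_succ m)) hm
    suffices F (m + 1) = F (m + 2) by rw [this]
    refine (hF (Nat.le_succ _)).antisymm (Submodule.span_le.2 ?_)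
    rintro _ ⟨x, hx, rfl⟩
    obtain ⟨a, ha, b, hb, rfl⟩ := exists_mul_of_mem_wordBall_add (m := m + 1) (n := 1) hx
    have h1 : φ ∘ₗ ρ a ∈ F m := hm' ▸ Submodule.subset_span ⟨a, ha, rfl⟩
    have h2 : F m ≤ (F (m + 1)).comap (LinearMap.lcomp ℂ ℂ (ρ b)) := by
      refine Submodule.span_le.2 ?_
      rintro _ ⟨c, hc, rfl⟩
      refine Submodule.subset_span ⟨c * b, mul_mem_wordBall hc hb, ?_⟩
      ext x
      simp
    have h3 := h2 h1
    have h4 : φ ∘ₗ ρ (a * b) = (φ ∘ₗ ρ a) ∘ₗ ρ b := by ext x; simp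
    rw [SetLike.mem_coe]
    show φ ∘ₗ ρ (a * b) ∈ _
    rw [h4]
    exact h3
  have hbd : ∀ m, Module.finrank ℂ (F m) ≤ Module.finrank ℤ M := fun m => by
    rw [← Module.finrank_linearMap_self ℤ ℂ M]
    exact Submodule.finrank_le _
  obtain ⟨n, hn⟩ := exists_mem_wordBall (X := X) (g := g) (by rw [hX]; trivial)
  have h1 := Nat.stabilises_of_monotone
    (fun m n hmn => Submodule.finrank_mono (hF hmn)) hbd hstab
    (le_max_left (Module.finrank ℤ M) n)
  have h2 : F (Module.finrank ℤ M) = F (max (Module.finrank ℤ M) n) :=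
    Submodule.eq_of_le_of_finrank_eq (hF (le_max_left _ _)) h1.symm
  have h3 : φ ∘ₗ ρ g ∈ F (Module.finrank ℤ M) :=
    h2 ▸ hF (le_max_right _ _) (Submodule.subset_span ⟨g, hn, rfl⟩)
  by_contra! hcon
  have h4 : F (Module.finrank ℤ M) ≤ LinearMap.ker (LinearMap.applyₗ' ℂ y :
      (M →ₗ[ℤ] ℂ) →ₗ[ℂ] ℂ) := by
    refine Submodule.span_le.2 ?_
    rintro _ ⟨c, hc, rfl⟩
    exact hcon c hc
  exact hg (h4 h3)

end Eigenvalues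

section AbelianTerm

/-- The automorphisms of a commutative group as endomorphisms of a `ℤ`-module. -/
def mulAutToEnd (A : Type*) [CommGroup A] : MulAut A →* Module.End ℤ (Additive A) where
  toFun γ := (MonoidHom.toAdditive γ.toMonoidHom).toIntLinearMap
  map_one' := rfl
  map_mul' _ _ := rfl

lemma exists_fixed_of_pow_sub_one_pow_eq_zero {A : Type*} [CommGroup A] {ζ : MulAut A} {N n : ℕ}
    (h : (mulAutToEnd A ζ ^ N - 1) ^ n = 0) {W : Subgroup A} (hW : W ≠ ⊥)
    (hζ : ∀ w ∈ W, ζ w ∈ W) : ∃ w ∈ W, w ≠ 1 ∧ (ζ ^ N) w = w := by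
  rw [← map_pow] at h
  have hN : ∀ N : ℕ, ∀ w ∈ W, (ζ ^ N) w ∈ W := by
    intro N
    induction N with
    | zero => exact fun w hw => hw
    | succ N ih => exact fun w hw => by rw [pow_succ]; exact ih _ (hζ w hw)
  have key : ∀ m : ℕ, ∀ w ∈ W, w ≠ 1 →
      ((mulAutToEnd A (ζ ^ N) - 1) ^ m) (Additive.ofMul w) = 0 →
      ∃ w ∈ W, w ≠ 1 ∧ (ζ ^ N) w = w := by
    intro m
    induction m with
    | zero => exact fun w _ hw1 h0 => absurd h0 hw1
    | succ m ih =>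
      intro w hw hw1 h0
      by_cases hfix : (ζ ^ N) w = w
      · exact ⟨w, hw, hw1, hfix⟩
      · refine ih ((ζ ^ N) w / w) (div_mem (hN N w hw) hw) (div_ne_one.2 hfix) ?_
        rw [pow_succ] at h0
        exact h0
  obtain ⟨w, hw, hw1⟩ := (Subgroup.bot_or_exists_ne_one W).resolve_left hW
  exact key n w hw hw1 (by rw [h]; rfl)

open Pointwise in
/-- A group of automorphisms with a nontrivial finite orbit keeps having one after adjoining
an automorphism which normalizes it and has periodic points in invariant subgroups. -/
lemma exists_finite_orbit_sup_zpowers {A : Type*} [Group A] {Γ : Subgroup (MulAut A)}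
    {ζ : MulAut A} (hζ : ζ ∈ Subgroup.normalizer (Γ : Set (MulAut A)))
    (hfix : ∀ W : Subgroup A, W ≠ ⊥ → (∀ w ∈ W, ζ w ∈ W) →
      ∃ N : ℕ, 0 < N ∧ ∃ w ∈ W, w ≠ 1 ∧ (ζ ^ N) w = w)
    (hΓ : ∃ w : A, w ≠ 1 ∧ ((fun γ : MulAut A => γ w) '' Γ).Finite) :
    ∃ w : A, w ≠ 1 ∧
      ((fun γ : MulAut A => γ w) '' (Γ ⊔ Subgroup.zpowers ζ : Subgroup (MulAut A))).Finite := by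
  let W : Subgroup A :=
    { carrier := {w | ((fun γ : MulAut A => γ w) '' Γ).Finite}
      one_mem' := (Set.finite_singleton (1 : A)).subset (by rintro _ ⟨γ, -, rfl⟩; simp)
      mul_mem' := fun {a b} ha hb => (ha.mul hb).subset (by
        rintro _ ⟨γ, hγ, rfl⟩
        exact ⟨γ a, ⟨γ, hγ, rfl⟩, γ b, ⟨γ, hγ, rfl⟩, (map_mul γ a b).symm⟩)
      inv_mem' := fun {a} ha => (ha.inv).subset (by
        rintro _ ⟨γ, hγ, rfl⟩
        exact ⟨γ, hγ, by simp⟩) }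
  have hconj : ∀ γ ∈ Γ, ∃ γ' ∈ Γ, γ * ζ = ζ * γ' := fun γ hγ =>
    ⟨ζ⁻¹ * γ * ζ, (Subgroup.mem_normalizer_iff''.1 hζ γ).1 hγ, by group⟩
  have hconj' : ∀ γ ∈ Γ, ∃ γ' ∈ Γ, ζ * γ = γ' * ζ := fun γ hγ =>
    ⟨ζ * γ * ζ⁻¹, (Subgroup.mem_normalizer_iff.1 hζ γ).1 hγ, by group⟩
  have hconjpow : ∀ j : ℕ, ∀ γ ∈ Γ, ∃ γ' ∈ Γ, γ * ζ ^ j = ζ ^ j * γ' := by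
    intro j
    induction j with
    | zero => exact fun γ hγ => ⟨γ, hγ, by simp⟩
    | succ j ih =>
      intro γ hγ
      obtain ⟨γ₁, h1, e1⟩ := ih γ hγ
      obtain ⟨γ₂, h2, e2⟩ := hconj γ₁ h1
      exact ⟨γ₂, h2, by rw [pow_succ, ← mul_assoc, e1, mul_assoc, e2, ← mul_assoc]⟩
  have hconjpow' : ∀ j : ℕ, ∀ γ ∈ Γ, ∃ γ' ∈ Γ, ζ ^ j * γ = γ' * ζ ^ j := by
    intro j
    induction j with
    | zero => exact fun γ hγ => ⟨γ, hγ, by simp⟩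
    | succ j ih =>
      intro γ hγ
      obtain ⟨γ₁, h1, e1⟩ := hconj' γ hγ
      obtain ⟨γ₂, h2, e2⟩ := ih γ₁ h1
      exact ⟨γ₂, h2, by rw [pow_succ, mul_assoc, e1, ← mul_assoc, e2, mul_assoc]⟩
  have hW : W ≠ ⊥ := by
    obtain ⟨w, hw1, hw⟩ := hΓ
    exact fun h => hw1 (Subgroup.mem_bot.1 (h ▸ (show w ∈ W from hw)))
  obtain ⟨N, hN, w, hw, hw1, hwN⟩ := hfix W hW fun w hw => by
    refine (Set.Finite.image ζ hw).subset ?_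
    rintro _ ⟨γ, hγ, rfl⟩
    obtain ⟨γ', h', e⟩ := hconj γ hγ
    exact ⟨γ' w, ⟨γ', h', rfl⟩, (congrArg (fun f : MulAut A => f w) e).symm⟩
  let O : Set A := ⋃ j ∈ Finset.range N, (ζ ^ j) '' ((fun γ : MulAut A => γ w) '' Γ)
  have hOfin : O.Finite := Set.Finite.biUnion (Finset.finite_toSet _) fun j _ => hw.image _
  have hmemO : ∀ {x : A}, x ∈ O ↔ ∃ j < N, ∃ γ ∈ Γ, (ζ ^ j) (γ w) = x := by
    intro x
    simp [O]
  have hstab : ∀ γ : MulAut A, (∀ x ∈ O, γ x ∈ O) → γ ∈ MulAction.stabilizer (MulAut A) O := by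
    intro γ hγ
    rw [MulAction.mem_stabilizer_iff]
    refine Set.eq_of_subset_of_ncard_le ?_ ?_ hOfin
    · rintro _ ⟨x, hx, rfl⟩
      exact hγ x hx
    · exact (Set.ncard_image_of_injective O γ.injective).ge
  have hle : Γ ⊔ Subgroup.zpowers ζ ≤ MulAction.stabilizer (MulAut A) O := by
    refine sup_le (fun γ hγ => hstab γ fun x hx => ?_) ?_
    · obtain ⟨j, hj, γ₁, h1, rfl⟩ := hmemO.1 hx
      obtain ⟨γ₂, h2, e⟩ := hconjpow j γ hγ
      exact hmemO.2 ⟨j, hj, γ₂ * γ₁, mul_mem h2 h1,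
        (congrArg (fun f : MulAut A => f (γ₁ w)) e).symm⟩
    · rw [Subgroup.zpowers_le]
      refine hstab ζ fun x hx => ?_
      obtain ⟨j, hj, γ, h1, rfl⟩ := hmemO.1 hx
      rcases Nat.lt_or_ge (j + 1) N with h | h
      · exact hmemO.2 ⟨j + 1, h, γ, h1, by rw [pow_succ']; rfl⟩
      · obtain rfl : N = j + 1 := by omega
        obtain ⟨γ', h', e⟩ := hconjpow' (j + 1) γ h1
        refine hmemO.2 ⟨0, hN, γ', h', ?_⟩
        have := congrArg (fun f : MulAut A => f w) e
        simp only [MulAut.mul_apply, hwN] at this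
        rw [pow_zero, MulAut.one_apply, ← this, pow_succ', MulAut.mul_apply]
  refine ⟨w, hw1, hOfin.subset ?_⟩
  rintro _ ⟨γ, hγ, rfl⟩
  have h1 : γ • O = O := hle hγ
  have h2 : w ∈ O := hmemO.2 ⟨0, hN, 1, one_mem Γ, by simp⟩
  rw [← h1]
  exact ⟨w, h2, rfl⟩

variable {G : Type*} [Group G]

lemma isFreePair_of_eigenfunctional {M : Type*} [AddCommGroup M] {e : M → G} {f : M → M}
    {φ : M →+ ℂ} {z : G} {μ : ℂ} {y : M} (hadd : ∀ x y, e (x + y) = e x * e y)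
    (hinj : Function.Injective e) (hconj : ∀ x, z * e x * z⁻¹ = e (f x))
    (hφ : ∀ x, φ (f x) = μ * φ x) (hμ : 2 ≤ ‖μ‖) (hy : φ y ≠ 0) : IsFreePair z (e y * z) := by
  have he0 : e 0 = 1 := by
    have := hadd 0 0
    rwa [add_zero, left_eq_mul] at this
  let val : List Bool → ℂ := fun l => l.foldr (fun b t => (if b then 1 else 0) + μ * t) 0
  have hword : ∀ l : List Bool, ∃ x, binaryWord z (e y * z) l = e x * z ^ l.length ∧
      φ x = φ y * val l := by
    intro l
    induction l with
    | nil => exact ⟨0, by simp [he0], by simp [val]⟩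
    | cons b l ih =>
      obtain ⟨x, hx, hv⟩ := ih
      cases b
      · refine ⟨f x, ?_, ?_⟩
        · simp [hx, ← hconj, pow_succ', mul_assoc]
        · rw [hφ, hv]
          simp only [val, List.foldr_cons, Bool.false_eq_true, if_false]
          ring
      · refine ⟨y + f x, ?_, ?_⟩
        · simp [hx, ← hconj, hadd, pow_succ', mul_assoc]
        · rw [map_add, hφ, hv]
          simp only [val, List.foldr_cons, if_true]
          ring
  have hgap : ∀ l l' : List Bool, l.length = l'.length → l ≠ l' → 1 ≤ ‖val l - val l'‖ := by
    intro l
    induction l with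
    | nil =>
      intro l' hl hne
      exact absurd (List.eq_nil_of_length_eq_zero hl.symm).symm hne
    | cons b l ih =>
      rintro (_ | ⟨b', l'⟩) hl hne
      · simp at hl
      · have hl' : l.length = l'.length := by simpa using hl
        have hval : val (b :: l) - val (b' :: l') =
            ((if b then 1 else 0) - (if b' then 1 else 0)) + μ * (val l - val l') := by
          simp only [val, List.foldr_cons]
          ring
        by_cases hll : l = l'
        · subst hll
          rw [hval]
          cases b <;> cases b' <;> simp at hne ⊢
        · have h1 := ih l' hl' hll
          have h2 : 2 ≤ ‖μ * (val l - val l')‖ := by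
            rw [norm_mul]
            nlinarith
          have h3 : ‖((if b then 1 else 0) - (if b' then 1 else 0) : ℂ)‖ ≤ 1 := by
            cases b <;> cases b' <;> simp
          rw [hval]
          have h4 := norm_sub_le (((if b then 1 else 0) - (if b' then 1 else 0) : ℂ) +
            μ * (val l - val l')) ((if b then 1 else 0) - (if b' then 1 else 0) : ℂ)
          rw [add_sub_cancel_left] at h4
          linarith
  intro l l' hl hw
  by_contra hne
  obtain ⟨x, hx, hv⟩ := hword l
  obtain ⟨x', hx', hv'⟩ := hword l'
  rw [hx, hx', hl, mul_left_inj] at hw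
  rw [hinj hw, hv'] at hv
  have := hgap l l' hl hne
  rw [mul_left_cancel₀ hy hv, sub_self, norm_zero] at this
  exact absurd this (by norm_num)

/-- A commutative term of the lower central series is trivial as soon as none of its nontrivial
elements has a finite conjugacy class. -/
theorem HasNoShortFreePairs.lowerCentralSeries_eq_bot (hG : HasNoShortFreePairs G) (s : ℕ)
    (hcomm : ∀ a ∈ (⊤ : Subgroup G).lowerCentralSeries s,
      ∀ b ∈ (⊤ : Subgroup G).lowerCentralSeries s, a * b = b * a)
    (hFC : ∀ a ∈ (⊤ : Subgroup G).lowerCentralSeries s,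
      (Set.range fun g : G => g * a * g⁻¹).Finite → a = 1) :
    (⊤ : Subgroup G).lowerCentralSeries s = ⊥ := by
  by_contra hbot
  rcases Nat.eq_zero_or_pos s with rfl | hs
  · refine hbot ((Subgroup.eq_bot_iff_forall _).2 fun a ha => hFC a ha ?_)
    refine (Set.finite_singleton a).subset ?_
    rintro _ ⟨g, rfl⟩
    simp [hcomm g trivial a ha]
  have hfg := hG.fg_lowerCentralSeries s
  have hKY := fun {X : Finset G} (hX : Subgroup.closure (X : Set G) = ⊤) =>
    (lowerCentralSeries_eq_normalClosure hX s).trans (conjClosure_top _).symm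
  have hYK := fun (X : Finset G) (c : G) (hc : IsCommutatorOver X s c) =>
    hc.mem_lowerCentralSeries
  have hnormal : ((⊤ : Subgroup G).lowerCentralSeries s).Normal := inferInstance
  generalize (⊤ : Subgroup G).lowerCentralSeries s = K at *
  let _ : CommGroup K :=
    { (inferInstance : Group K) with
      mul_comm := fun a b => Subtype.ext (hcomm a a.2 b b.2) }
  let c : G →* MulAut K := MulAut.conjNormal
  have hc : ∀ (g : G) (a : K), (c g a : G) = g * a * g⁻¹ := MulAut.conjNormal_apply
  have hfinite : ∀ a : K, (Set.range fun g : G => c g a).Finite → a = 1 := by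
    intro a ha
    refine Subtype.ext (hFC a a.2 ((ha.image Subtype.val).subset ?_))
    rintro _ ⟨g, rfl⟩
    exact ⟨c g a, ⟨g, rfl⟩, hc g a⟩
  have : Group.FG K := (Group.fg_iff_subgroup_fg K).2 hfg
  have : Module.Finite ℤ (Additive K) := Module.Finite.iff_addGroup_fg.2 inferInstance
  have : Module.IsTorsionFree ℤ (Additive K) := by
    rw [Submodule.isTorsionFree_iff_torsion_eq_bot, Submodule.eq_bot_iff]
    intro x hx
    have hfin : Finite (Submodule.torsion ℤ (Additive K)) :=
      Module.finite_of_fg_torsion _ (Submodule.torsion_isTorsion)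
    refine hfinite x.toMul (Set.Finite.subset
      (Set.toFinite (Submodule.torsion ℤ (Additive K) : Set (Additive K))) ?_)
    rintro _ ⟨g, rfl⟩
    obtain ⟨k, hk⟩ := hx
    refine ⟨k, ?_⟩
    have := congrArg (mulAutToEnd K (c g)) hk
    rw [map_zero, Submonoid.smul_def, map_smul] at this
    exact this
  have : Module.Free ℤ (Additive K) := Module.free_of_finite_type_torsion_free'
  let ρ : G →* Module.End ℤ (Additive K) := (mulAutToEnd K).comp c
  set n := Module.finrank ℤ (Additive K) with hn
  obtain ⟨k, hk⟩ := exists_forall_root_pow_eq_one n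
  obtain ⟨X, hX, hfree⟩ := hG (2 * n + 4 ^ s + k * 4 ^ s)
  have hunip : ∀ j < s, ∀ z, IsCommutatorOver X j z →
      ∃ N m : ℕ, 0 < N ∧ (ρ z ^ N - 1) ^ m = 0 := by
    intro j hj z hz
    have hsurj : Function.Surjective (ρ z) := fun x => ⟨ρ z⁻¹ x, by
      rw [← Module.End.mul_apply, ← map_mul]; simp⟩
    refine exists_pow_sub_one_pow_eq_zero _ fun μ hμ => hk _ (LinearMap.charpoly_monic _)
      (LinearMap.charpoly_natDegree _) (fun μ hμ => ?_) μ hμ ?_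
    · by_contra! hge
      obtain ⟨φ, hφ0, hφ⟩ := exists_eigenfunctional (ρ z) hμ
      have hy : ∃ y : K, IsCommutatorOver X s (y : G) ∧
          ∃ g, φ (ρ g (Additive.ofMul y)) ≠ 0 := by
        by_contra! hcon
        refine hφ0 (LinearMap.ext fun x => ?_)
        let L : Subgroup K :=
          { carrier := {a | φ (Additive.ofMul a) = 0}
            one_mem' := map_zero φ
            mul_mem' := fun {a b} ha hb => by
              rw [Set.mem_ofPred_eq] at *
              rw [ofMul_mul, map_add, ha, hb, add_zero]
            inv_mem' := fun {a} ha => by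
              rw [Set.mem_ofPred_eq] at *
              rw [ofMul_inv, map_neg, ha, neg_zero] }
        have hle : K ≤ L.map K.subtype := by
          refine (hKY hX).le.trans ((Subgroup.closure_le _).2 ?_)
          rintro _ ⟨g, -, y, hy, rfl⟩
          exact ⟨c g ⟨y, hYK X y hy⟩, hcon ⟨y, hYK X y hy⟩ hy g, hc g _⟩
        obtain ⟨a, ha, hax⟩ := hle x.toMul.2
        rw [show a = x.toMul from Subtype.ext hax] at ha
        exact ha
      obtain ⟨y, hy, g, hg⟩ := hy
      obtain ⟨r, hr, hφr⟩ := exists_mem_wordBall_map_ne_zero hX ρ φ hg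
      have hpow : ∀ (i : ℕ) x, φ (ρ (z ^ i) x) = μ ^ i * φ x := by
        intro i
        induction i with
        | zero => simp
        | succ i ih =>
          intro x
          rw [pow_succ, map_mul, Module.End.mul_apply, ih, hφ, pow_succ, mul_assoc]
      have hpair : IsFreePair (z ^ k) ((c r y : K) * z ^ k) :=
        isFreePair_of_eigenfunctional (M := Additive K) (e := fun x => (x.toMul : G))
          (f := ρ (z ^ k)) (φ := φ.toAddMonoidHom) (y := ρ r (Additive.ofMul y))
          (fun _ _ => rfl) (fun x y h => Subtype.ext h) (fun x => (hc _ _).symm)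
          (hpow k) (by rwa [norm_pow]) hφr
      have hz' : z ^ k ∈ wordBall X (k * 4 ^ s) := by
        refine pow_mem_wordBall (wordBall_mono X ?_ hz.mem_wordBall) k
        exact Nat.pow_le_pow_right (by norm_num) hj.le
      have hc' : (c r y : G) ∈ wordBall X (n + 4 ^ s + n) := by
        rw [hc]
        exact mul_mem_wordBall (mul_mem_wordBall hr hy.mem_wordBall) (inv_mem_wordBall hr)
      exact hfree _ (wordBall_mono X (Nat.le_add_left _ _) hz') _
        (wordBall_mono X (le_of_eq (by ring)) (mul_mem_wordBall hc' hz')) hpair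
    · rintro rfl
      obtain ⟨φ, hφ0, hφ⟩ := exists_eigenfunctional (ρ z) hμ
      refine hφ0 (LinearMap.ext fun x => ?_)
      obtain ⟨x, rfl⟩ := hsurj x
      simp [hφ]
  obtain ⟨w, hw1, hw⟩ := IsCommutatorOver.induction_top hX hs
    (fun B => ∃ w : K, w ≠ 1 ∧ ((fun γ : MulAut K => γ w) '' (B.map c)).Finite) (by
      obtain ⟨w, hw, hw1⟩ := (Subgroup.bot_or_exists_ne_one K).resolve_left hbot
      refine ⟨⟨w, hw⟩, fun h => hw1 (congrArg Subtype.val h), ?_⟩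
      rw [Subgroup.map_bot]
      exact (Set.finite_singleton (1 : MulAut K)).image _) (by
      intro B z j hj hz hB h1 h2
      have hle : (Subgroup.closure (B ∪ {y | IsCommutatorOver X s y})) ≤ (B.map c).comap c := by
        refine (Subgroup.closure_le _).2 (Set.union_subset (fun b hb => ⟨b, hb, rfl⟩) ?_)
        intro y hy
        have : c y = 1 := by
          ext a
          rw [hc, hcomm y (hYK X y hy) a a.2]
          simp
        rw [SetLike.mem_coe, Subgroup.mem_comap, this]
        exact one_mem _
      rw [Subgroup.map_sup, MonoidHom.map_zpowers]
      refine exists_finite_orbit_sup_zpowers ?_ (fun W hW hzW => ?_) hB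
      · refine Subgroup.mem_normalizer_iff.2 fun γ => ⟨?_, fun hγ => ?_⟩
        · rintro ⟨b, hb, rfl⟩
          rw [← map_mul, ← map_inv, ← map_mul]
          exact hle (h1 b hb)
        · obtain ⟨b, hb, hbγ⟩ := hγ
          have := hle (h2 b hb)
          rw [Subgroup.mem_comap, map_mul, map_mul, hbγ, map_inv] at this
          simpa [mul_assoc] using this
      · obtain ⟨N, m, hN, hm⟩ := hunip j hj z hz
        exact ⟨N, hN, exists_fixed_of_pow_sub_one_pow_eq_zero hm hW hzW⟩)
  refine hw1 (hfinite w (hw.subset ?_))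
  rintro _ ⟨g, rfl⟩
  exact ⟨c g, ⟨g, trivial, rfl⟩, rfl⟩

end AbelianTerm

section LocallyDescending

/-- Groups in which one reaches the trivial group by repeatedly passing from a finitely generated
subgroup `K` to a normal subgroup of `K` with finite or commutative quotient. -/
inductive LocallyDescending : (G : Type u) → Group G → Prop
  | trivial (G : Type u) [inst : Group G] (h : Subsingleton G) : LocallyDescending G inst
  | descend (G : Type u) [inst : Group G] (N : Subgroup G → Subgroup G)
      (h : ∀ K : Subgroup G, K.FG → N K ≤ K ∧ K ≤ Subgroup.normalizer (N K : Set G) ∧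
        ((N K).relIndex K ≠ 0 ∨ ⁅K, K⁆ ≤ N K))
      (hN : ∀ K : Subgroup G, K.FG → LocallyDescending (N K) inferInstance) :
      LocallyDescending G inst

lemma Subgroup.FG.exists_map_eq {L G : Type*} [Group L] [Group G] {f : L →* G} {K : Subgroup G}
    (hK : K.FG) (hf : K ≤ f.range) : ∃ K₀ : Subgroup L, K₀.FG ∧ K₀.map f = K := by
  obtain ⟨S, rfl, hS⟩ := (Subgroup.fg_iff K).1 hK
  have hSf : ∀ x ∈ S, ∃ y, f y = x := fun x hx => hf (Subgroup.subset_closure hx)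
  choose! g hg using hSf
  refine ⟨Subgroup.closure (g '' S), (Subgroup.fg_iff _).2 ⟨g '' S, rfl, hS.image g⟩, ?_⟩
  rw [MonoidHom.map_closure, Set.image_image, Set.image_congr hg, Set.image_id']

lemma Subgroup.FG.exists_le_of_directed {G ι : Type*} [Group G] [Nonempty ι] {S : Subgroup G}
    (hS : S.FG) {K : ι → Subgroup G} (hdir : Directed (· ≤ ·) K) (hle : S ≤ ⨆ i, K i) :
    ∃ i, S ≤ K i := by
  obtain ⟨T, rfl, hT⟩ := (Subgroup.fg_iff S).1 hS
  clear hS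
  simp only [Subgroup.closure_le] at hle ⊢
  induction T, hT using Set.Finite.induction_on with
  | empty => exact ⟨Classical.arbitrary ι, Set.empty_subset _⟩
  | @insert x T _ _ ih =>
    obtain ⟨i, hi⟩ := ih ((Set.subset_insert x T).trans hle)
    obtain ⟨j, hj⟩ := (Subgroup.mem_iSup_of_directed hdir).1 (hle (Set.mem_insert x T))
    obtain ⟨k, hik, hjk⟩ := hdir i j
    exact ⟨k, Set.insert_subset (hjk hj) (hi.trans hik)⟩

namespace LocallyDescending

lemma of_forall_exists {G : Type u} [inst : Group G]
    (h : ∀ K : Subgroup G, K.FG → ∃ N : Subgroup G, (N ≤ K ∧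
      K ≤ Subgroup.normalizer (N : Set G) ∧ (N.relIndex K ≠ 0 ∨ ⁅K, K⁆ ≤ N)) ∧
      LocallyDescending N inferInstance) : LocallyDescending G inst := by
  choose! N h1 h2 using h
  exact .descend G N h1 h2

/-- Closure under quotients of subgroups. -/
theorem of_section {G : Type u} {instG : Group G} (hG : LocallyDescending G instG) :
    ∀ {L H : Type u} [Group L] [instH : Group H] (i : L →* G) (p : L →* H),
      Function.Injective i → Function.Surjective p → LocallyDescending H instH := by
  induction hG with
  | trivial G h =>
    intro L H _ _ i p hi hp
    have : Subsingleton L := hi.subsingleton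
    exact .trivial H hp.subsingleton
  | descend G N h hN ih =>
    intro L H _ _ i p hi hp
    refine of_forall_exists fun K' hK' => ?_
    obtain ⟨K₀, hK₀, rfl⟩ := hK'.exists_map_eq (f := p)
      (by rw [MonoidHom.range_eq_top.2 hp]; exact le_top)
    have hfg := hK₀.map_hom i
    obtain ⟨h1, h2, h3⟩ := h _ hfg
    set N₀ := (N (K₀.map i)).comap i with hN₀
    refine ⟨N₀.map p, ⟨Subgroup.map_mono ?_, ?_, ?_⟩, ?_⟩
    · exact (Subgroup.comap_mono h1).trans (Subgroup.comap_map_eq_self_of_injective hi K₀).le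
    · refine (Subgroup.map_mono ?_).trans (Subgroup.le_normalizer_map p)
      exact (Subgroup.map_le_iff_le_comap.1 h2).trans (Subgroup.le_normalizer_comap i)
    · refine h3.imp (fun h3 => ?_) fun h3 => ?_
      · rw [← Subgroup.relIndex_comap]
        rw [← Subgroup.relIndex_comap] at h3
        exact fun h0 => h3 (Nat.eq_zero_of_zero_dvd
          (h0 ▸ Subgroup.relIndex_dvd_of_le_left K₀ (Subgroup.le_comap_map p N₀)))
      · rw [← Subgroup.map_commutator] at h3 ⊢
        exact Subgroup.map_mono (Subgroup.map_le_iff_le_comap.1 h3)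
    · refine ih _ hfg (L := N₀) ((i.comp N₀.subtype).codRestrict _ fun x => x.2)
        (p.subgroupMap N₀) (fun x y hxy => ?_) (p.subgroupMap_surjective N₀)
      exact Subtype.ext (hi (congrArg Subtype.val hxy))

lemma of_injective {G H : Type u} {instG : Group G} [instH : Group H]
    (hG : LocallyDescending G instG) (f : H →* G) (hf : Function.Injective f) :
    LocallyDescending H instH :=
  hG.of_section f (MonoidHom.id H) hf Function.surjective_id

lemma of_surjective {G H : Type u} {instG : Group G} [instH : Group H]
    (hG : LocallyDescending G instG) (f : G →* H) (hf : Function.Surjective f) :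
    LocallyDescending H instH :=
  hG.of_section (MonoidHom.id G) f Function.injective_id hf

lemma exists_of_fg {G : Type u} {instG : Group G} (hG : LocallyDescending G instG)
    {K : Subgroup G} (hK : K.FG) : ∃ N : Subgroup G, (N ≤ K ∧
      K ≤ Subgroup.normalizer (N : Set G) ∧ (N.relIndex K ≠ 0 ∨ ⁅K, K⁆ ≤ N)) ∧
      LocallyDescending N inferInstance := by
  cases hG with
  | trivial _ h => exact ⟨K, ⟨le_rfl, Subgroup.le_normalizer, .inr (Subgroup.commutator_le_self K)⟩,
      .trivial K inferInstance⟩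
  | descend _ N h hN => exact ⟨N K, h K hK, hN K hK⟩

theorem extension {Q : Type u} {instQ : Group Q} (hQ : LocallyDescending Q instQ) :
    ∀ {G : Type u} [instG : Group G] (π : G →* Q), LocallyDescending π.ker inferInstance →
      LocallyDescending G instG := by
  induction hQ with
  | trivial Q h =>
    intro G _ π hker
    exact hker.of_surjective π.ker.subtype fun g =>
      ⟨⟨g, Subsingleton.elim _ _⟩, rfl⟩
  | descend Q N h hN ih =>
    intro G _ π hker
    refine of_forall_exists fun K hK => ?_
    have hfg := hK.map_hom π
    obtain ⟨h1, h2, h3⟩ := h _ hfg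
    refine ⟨K ⊓ (N (K.map π)).comap π, ⟨inf_le_left, ?_, ?_⟩, ?_⟩
    · exact Subgroup.le_normalizer_of_conj_mem fun b hb t ht =>
        ⟨K.mul_mem (K.mul_mem hb ht.1) (K.inv_mem hb), by
          have := Subgroup.conj_mem_of_mem_normalizer (h2 ⟨b, hb, rfl⟩) ht.2
          simpa using this⟩
    · refine h3.imp (fun h3 => ?_) fun h3 => ?_
      · rwa [Subgroup.inf_relIndex_left, Subgroup.relIndex_comap]
      · rw [← Subgroup.map_commutator] at h3
        exact le_inf (Subgroup.commutator_le_self K) (Subgroup.map_le_iff_le_comap.1 h3)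
    · set N' := K ⊓ (N (K.map π)).comap π
      let π' : N' →* N (K.map π) := (π.comp N'.subtype).codRestrict _ fun x => x.2.2
      refine ih _ hfg π' (hker.of_injective
        (((N'.subtype).comp π'.ker.subtype).codRestrict π.ker fun x => ?_) fun x y hxy => ?_)
      · exact congrArg Subtype.val x.2
      · exact Subtype.ext (Subtype.ext (congrArg (fun t : π.ker => (t : G)) hxy))

theorem directedUnion {G : Type u} [instG : Group G] {ι : Type u} (K : ι → Subgroup G)
    (hdir : Directed (· ≤ ·) K) (htop : ⨆ i, K i = ⊤)
    (h : ∀ i, LocallyDescending (K i) inferInstance) : LocallyDescending G instG := by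
  rcases isEmpty_or_nonempty ι with hι | hι
  · rw [iSup_of_empty] at htop
    exact .trivial G (Subgroup.subsingleton_iff.1 (subsingleton_of_bot_eq_top htop))
  refine of_forall_exists fun S hS => ?_
  obtain ⟨i, hSi⟩ := hS.exists_le_of_directed hdir (htop ▸ le_top)
  obtain ⟨S₀, hS₀, rfl⟩ := hS.exists_map_eq (f := (K i).subtype) (by simpa using hSi)
  obtain ⟨N, ⟨h1, h2, h3⟩, hN⟩ := (h i).exists_of_fg hS₀
  refine ⟨N.map (K i).subtype, ⟨Subgroup.map_mono h1, ?_, ?_⟩, ?_⟩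
  · exact (Subgroup.map_mono h2).trans (Subgroup.le_normalizer_map _)
  · refine h3.imp (fun h3 => ?_) fun h3 => ?_
    · rwa [← Subgroup.relIndex_comap,
        Subgroup.comap_map_eq_self_of_injective (K i).subtype_injective]
    · rw [← Subgroup.map_commutator]
      exact Subgroup.map_mono h3
  · exact hN.of_surjective ((K i).subtype.subgroupMap N) (MonoidHom.subgroupMap_surjective _ N)

end LocallyDescending

theorem ElementaryAmenable.locallyDescending {G : Type u} {instG : Group G}
    (hG : ElementaryAmenable G instG) : LocallyDescending G instG := by
  induction hG with
  | abelian G h =>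
    refine .of_forall_exists fun K _ => ⟨⊥, ⟨bot_le, ?_, .inr ?_⟩, .trivial _ inferInstance⟩
    · rw [Subgroup.normalizer_eq_top]
      exact le_top
    · exact Subgroup.commutator_le.2 fun a _ b _ =>
        Subgroup.mem_bot.2 (commutatorElement_eq_one_iff_mul_comm.2 (h a b))
  | finite G h =>
    refine .of_forall_exists fun K _ => ⟨⊥, ⟨bot_le, ?_, .inl ?_⟩, .trivial _ inferInstance⟩
    · rw [Subgroup.normalizer_eq_top]
      exact le_top
    · rw [Subgroup.relIndex_bot_left]
      exact Nat.card_pos.ne'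
  | subgroup f hf _ ih => exact ih.of_injective f hf
  | quotient f hf _ ih => exact ih.of_surjective f hf
  | @extension G instG N hN _ _ ih1 ih2 =>
    refine ih2.extension (QuotientGroup.mk' N) (ih1.of_surjective
      (Subgroup.inclusion (QuotientGroup.ker_mk' N).ge) fun x => ?_)
    exact ⟨⟨x, (QuotientGroup.ker_mk' N).le x.2⟩, rfl⟩
  | directedUnion K hdir htop _ ih => exact .directedUnion K hdir htop ih

end LocallyDescending

section JustNonVirtuallyNilpotent

/-- Some term of the lower central series of a normal subgroup of finite index lies in `N`. -/
def Subgroup.VirtuallyNilpotentModulo {G : Type*} [Group G] (N : Subgroup G) : Prop :=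
  ∃ H : Subgroup G, H.Normal ∧ H.FiniteIndex ∧ ∃ s, H.lowerCentralSeries s ≤ N

lemma Subgroup.VirtuallyNilpotentModulo.map {G Q : Type*} [Group G] [Group Q] {f : G →* Q}
    (hf : Function.Surjective f) {N : Subgroup G} (hN : N.VirtuallyNilpotentModulo) :
    (N.map f).VirtuallyNilpotentModulo := by
  obtain ⟨H, hH, hfi, s, hs⟩ := hN
  refine ⟨H.map f, hH.map f hf, ⟨fun h0 => hfi.index_ne_zero ?_⟩, s, ?_⟩
  · exact Nat.eq_zero_of_zero_dvd (h0 ▸ H.index_map_dvd hf)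
  · rw [← Subgroup.map_lowerCentralSeries]
    exact Subgroup.map_mono hs

lemma Subgroup.VirtuallyNilpotentModulo.comap {G Q : Type*} [Group G] [Group Q] {f : G →* Q}
    (hf : Function.Surjective f) {R : Subgroup Q} (hR : R.VirtuallyNilpotentModulo) :
    (R.comap f).VirtuallyNilpotentModulo := by
  obtain ⟨H, hH, hfi, s, hs⟩ := hR
  refine ⟨H.comap f, hH.comap f, ⟨?_⟩, s, ?_⟩
  · rw [H.index_comap_of_surjective hf]
    exact hfi.index_ne_zero
  rw [← Subgroup.map_le_iff_le_comap, Subgroup.map_lowerCentralSeries,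
    Subgroup.map_comap_eq_self_of_surjective hf]
  exact hs

lemma HasNoShortFreePairs.fg_lowerCentralSeries_subgroup {G : Type*} [Group G]
    (hG : HasNoShortFreePairs G) (H : Subgroup G) [H.Normal] [H.FiniteIndex] (s : ℕ) :
    (H.lowerCentralSeries s).FG := by
  rw [← Subgroup.top_subtype_lowerCentralSeries]
  exact ((hG.subgroup H).fg_lowerCentralSeries s).map_hom H.subtype

lemma Subgroup.FiniteIndex.finite_conj {G : Type*} [Group G] (H : Subgroup G) [H.FiniteIndex]
    {a : G} (ha : (Set.range fun h : H => (h : G) * a * (h : G)⁻¹).Finite) :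
    (Set.range fun g : G => g * a * g⁻¹).Finite := by
  have : Finite (G ⧸ H) := inferInstance
  refine (Set.finite_iUnion fun q : G ⧸ H => ha.image fun x => q.out * x * q.out⁻¹).subset ?_
  rintro _ ⟨g, rfl⟩
  obtain ⟨h, hh⟩ := QuotientGroup.mk_out_eq_mul H g
  refine Set.mem_iUnion.2 ⟨(g : G ⧸ H), _, ⟨h⁻¹, rfl⟩, ?_⟩
  simp only [hh, InvMemClass.coe_inv]
  group

/-- A normal subgroup, finitely generated as a group, contains below each of its normal subgroups
of finite index one which is normal in the whole group. -/
lemma Subgroup.exists_normal_relIndex_ne_zero {G : Type*} [Group G] {M : Subgroup G} [M.Normal]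
    (hM : M.FG) {N : Subgroup G} (hN : M ≤ Subgroup.normalizer (N : Set G))
    (hfin : N.relIndex M ≠ 0) : ∃ E : Subgroup G, E.Normal ∧ E ≤ N ∧ E.relIndex M ≠ 0 := by
  have hnorm : (N.subgroupOf M).Normal := Subgroup.normal_subgroupOf_of_le_normalizer hN
  have hfi : (N.subgroupOf M).FiniteIndex := ⟨hfin⟩
  let Q := M ⧸ N.subgroupOf M
  have hhom : Finite (M →* Q) := by
    obtain ⟨S, hS, hSfin⟩ := Group.fg_iff.1 ((Group.fg_iff_subgroup_fg M).2 hM)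
    have : Finite S := hSfin
    refine Finite.of_injective (fun (f : M →* Q) (x : S) => f x) fun f g hfg => ?_
    exact MonoidHom.eq_of_eqOn_dense hS fun x hx => congrFun hfg ⟨x, hx⟩
  let E : Subgroup M := ⨅ f : M →* Q, f.ker
  have hEchar : E.Characteristic := by
    refine Subgroup.characteristic_iff_le_comap.2 fun φ x hx => ?_
    simp only [E, Subgroup.mem_comap, Subgroup.mem_iInf, MonoidHom.mem_ker] at hx ⊢
    exact fun f => hx (f.comp φ.toMonoidHom)
  have hEfi : E.FiniteIndex := Subgroup.finiteIndex_iInf fun f => Subgroup.finiteIndex_ker f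
  refine ⟨E.map M.subtype, inferInstance, ?_, ?_⟩
  · rintro _ ⟨x, hx, rfl⟩
    have := (Subgroup.mem_iInf.1 hx) (QuotientGroup.mk' (N.subgroupOf M))
    rw [QuotientGroup.ker_mk'] at this
    exact this
  · rw [Subgroup.relIndex, Subgroup.subgroupOf,
      Subgroup.comap_map_eq_self_of_injective M.subtype_injective]
    exact hEfi.index_ne_zero

variable {G : Type u} [instG : Group G]

lemma eq_one_of_finite_conj (hbot : ¬ (⊥ : Subgroup G).VirtuallyNilpotentModulo)
    (hmin : ∀ R : Subgroup G, R.Normal → R ≠ ⊥ → R.VirtuallyNilpotentModulo) {g : G}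
    (hg : (Set.range fun x : G => x * g * x⁻¹).Finite) : g = 1 := by
  by_contra hne
  obtain ⟨H, hH, hfi, s, hs⟩ := hmin (Subgroup.normalClosure {g}) inferInstance fun h =>
    hne (Subgroup.mem_bot.1 (h ▸ Subgroup.subset_normalClosure rfl))
  have : Finite (MulAction.orbit (ConjAct G) g) := by
    refine (hg.subset ?_).to_subtype
    rintro _ ⟨x, rfl⟩
    exact ⟨ConjAct.ofConjAct x, (ConjAct.smul_def x g).symm⟩
  let f := (MulAction.toPermHom (ConjAct G) (MulAction.orbit (ConjAct G) g)).comp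
    (ConjAct.toConjAct (G := G)).toMonoidHom
  have hf : ∀ x ∈ f.ker, x * g * x⁻¹ = g := fun x hx => by
    have := congrArg Subtype.val (Equiv.congr_fun (MonoidHom.mem_ker.1 hx)
      (⟨g, MulAction.mem_orbit_self g⟩ : MulAction.orbit (ConjAct G) g))
    exact this
  have hfi' : f.ker.FiniteIndex := Subgroup.finiteIndex_ker f
  have hle : Subgroup.normalClosure {g} ≤ Subgroup.centralizer (f.ker : Set G) := by
    refine Subgroup.normalClosure_le_normal (Set.singleton_subset_iff.2 ?_)
    exact Subgroup.mem_centralizer_iff.2 fun x hx => mul_inv_eq_iff_eq_mul.1 (hf x hx)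
  refine hbot ⟨H ⊓ f.ker, inferInstance, inferInstance, s + 1, ?_⟩
  rw [Subgroup.lowerCentralSeries_succ]
  refine (Subgroup.commutator_mono ((Subgroup.lowerCentralSeries_mono s inf_le_left).trans hs)
    inf_le_right).trans ?_
  exact (Subgroup.commutator_eq_bot_iff_le_centralizer.2 hle).le

lemma not_commutative_lowerCentralSeries (hG : HasNoShortFreePairs G)
    (hbot : ¬ (⊥ : Subgroup G).VirtuallyNilpotentModulo)
    (hmin : ∀ R : Subgroup G, R.Normal → R ≠ ⊥ → R.VirtuallyNilpotentModulo)
    (H : Subgroup G) [H.Normal] [H.FiniteIndex] (s : ℕ) :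
    ⁅H.lowerCentralSeries s, H.lowerCentralSeries s⁆ ≠ ⊥ := by
  intro hcomm
  refine hbot ⟨H, inferInstance, inferInstance, s, ?_⟩
  have hmem : ∀ a ∈ (⊤ : Subgroup H).lowerCentralSeries s, (a : G) ∈ H.lowerCentralSeries s :=
    fun a ha => by
      rw [← Subgroup.top_subtype_lowerCentralSeries]
      exact ⟨a, ha, rfl⟩
  rw [← Subgroup.top_subtype_lowerCentralSeries,
    (hG.subgroup H).lowerCentralSeries_eq_bot s (fun a ha b hb => ?_) fun a _ hfin => ?_,
    Subgroup.map_bot]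
  · exact Subtype.ext (Subgroup.mem_centralizer_iff.1
      (Subgroup.commutator_eq_bot_iff_le_centralizer.1 hcomm (hmem b hb)) a (hmem a ha))
  · refine Subtype.ext (eq_one_of_finite_conj hbot hmin (Subgroup.FiniteIndex.finite_conj H ?_))
    refine (hfin.image Subtype.val).subset ?_
    rintro _ ⟨h, rfl⟩
    exact ⟨_, ⟨h, rfl⟩, rfl⟩

lemma eq_bot_of_finite (hbot : ¬ (⊥ : Subgroup G).VirtuallyNilpotentModulo)
    (hmin : ∀ R : Subgroup G, R.Normal → R ≠ ⊥ → R.VirtuallyNilpotentModulo)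
    (F : Subgroup G) [hF : F.Normal] [Finite F] : F = ⊥ := by
  refine (Subgroup.eq_bot_iff_forall F).2 fun g hg => eq_one_of_finite_conj hbot hmin ?_
  refine (Set.toFinite (F : Set G)).subset ?_
  rintro _ ⟨x, rfl⟩
  exact hF.conj_mem g hg x

lemma LocallyDescending.eq_bot_of_le_range (hG : HasNoShortFreePairs G)
    (hbot : ¬ (⊥ : Subgroup G).VirtuallyNilpotentModulo)
    (hmin : ∀ R : Subgroup G, R.Normal → R ≠ ⊥ → R.VirtuallyNilpotentModulo)
    {L : Type u} {instL : Group L} (hL : LocallyDescending L instL) :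
    ∀ (f : L →* G), Function.Injective f → ∀ R : Subgroup G, R.Normal → R ≤ f.range →
      R = ⊥ := by
  induction hL with
  | trivial L h =>
    rintro f - R - hR
    refine (Subgroup.eq_bot_iff_forall R).2 fun x hx => ?_
    obtain ⟨y, rfl⟩ := hR hx
    rw [Subsingleton.elim y 1, map_one]
  | descend L N h hN ih =>
    intro f hf R hRn hR
    by_contra hne
    obtain ⟨H, hH, hfi, s, hs⟩ := hmin R hRn hne
    have hMnorm : (H.lowerCentralSeries s).Normal := inferInstance
    have hMfg := hG.fg_lowerCentralSeries_subgroup H s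
    have hMcomm := not_commutative_lowerCentralSeries hG hbot hmin H s
    generalize H.lowerCentralSeries s = M at hs hMnorm hMfg hMcomm
    have hMbot : M ≠ ⊥ := by
      rintro rfl
      exact hMcomm (Subgroup.commutator_bot_left _)
    obtain ⟨K, hK, rfl⟩ := hMfg.exists_map_eq (hs.trans hR)
    obtain ⟨h1, h2, h3⟩ := h K hK
    have hsmall : ∀ E : Subgroup G, E.Normal → E ≤ (N K).map f → E = ⊥ := fun E hE hle =>
      ih K hK (f.comp (N K).subtype) (hf.comp (N K).subtype_injective) E hE <| by
        rwa [MonoidHom.range_comp, Subgroup.range_subtype]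
    rcases h3 with h3 | h3
    · obtain ⟨E, hE, hEN, hEi⟩ := Subgroup.exists_normal_relIndex_ne_zero hMfg
        (N := (N K).map f) ((Subgroup.map_mono h2).trans (Subgroup.le_normalizer_map f)) (by
          rwa [← Subgroup.relIndex_comap, Subgroup.comap_map_eq_self_of_injective hf])
      rw [hsmall E hE hEN, Subgroup.relIndex_bot_left] at hEi
      have := (Nat.card_ne_zero.1 hEi).2
      exact hMbot (eq_bot_of_finite hbot hmin _)
    · refine hMcomm (hsmall _ inferInstance ?_)
      rw [← Subgroup.map_commutator]
      exact Subgroup.map_mono h3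

end JustNonVirtuallyNilpotent

theorem HasNoShortFreePairs.virtuallyNilpotentModulo_bot {G : Type u} [instG : Group G]
    (hG : HasNoShortFreePairs G) (hLD : LocallyDescending G instG) :
    (⊥ : Subgroup G).VirtuallyNilpotentModulo := by
  by_contra hcon
  obtain ⟨N, -, ⟨hNn, hN⟩, hNmax⟩ := zorn_le_nonempty₀
    {N : Subgroup G | N.Normal ∧ ¬ N.VirtuallyNilpotentModulo} (fun c hc hchain y hy => by
      have : Nonempty c := ⟨⟨y, hy⟩⟩
      have hdir : Directed (· ≤ ·) fun N : c => (N : Subgroup G) :=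
        hchain.directedOn.directed_val
      refine ⟨⨆ N : c, (N : Subgroup G), ⟨⟨fun x hx g => ?_⟩, ?_⟩,
        fun z hz => le_iSup (fun N : c => (N : Subgroup G)) ⟨z, hz⟩⟩
      · obtain ⟨N, hN⟩ := (Subgroup.mem_iSup_of_directed hdir).1 hx
        exact (Subgroup.mem_iSup_of_directed hdir).2 ⟨N, (hc N.2).1.conj_mem x hN g⟩
      · rintro ⟨H, hH, hfi, s, hs⟩
        obtain ⟨N, hN⟩ :=
          (hG.fg_lowerCentralSeries_subgroup H s).exists_le_of_directed hdir hs
        exact (hc N.2).2 ⟨H, hH, hfi, s, hN⟩) ⊥ ⟨inferInstance, hcon⟩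
  have hsurj := QuotientGroup.mk'_surjective N
  have hbot : ¬ (⊥ : Subgroup (G ⧸ N)).VirtuallyNilpotentModulo := fun h => hN <| by
    simpa [MonoidHom.comap_bot] using h.comap hsurj
  have hmin : ∀ R : Subgroup (G ⧸ N), R.Normal → R ≠ ⊥ → R.VirtuallyNilpotentModulo := by
    intro R hR hne
    by_contra hR'
    refine hne ((Subgroup.eq_bot_iff_forall R).2 fun x hx => ?_)
    obtain ⟨g, rfl⟩ := hsurj x
    have hle : N ≤ R.comap (QuotientGroup.mk' N) :=
      (QuotientGroup.ker_mk' N).ge.trans (Subgroup.ker_le_comap _ R)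
    refine (QuotientGroup.eq_one_iff g).2 (hNmax ⟨hR.comap _, fun h => hR' ?_⟩ hle hx)
    simpa [Subgroup.map_comap_eq_self_of_surjective hsurj] using h.map hsurj
  have htop := (hLD.of_surjective (QuotientGroup.mk' N) hsurj).eq_bot_of_le_range
    (hG.of_surjective hsurj) hbot hmin (MonoidHom.id _) Function.injective_id ⊤ inferInstance
    (fun x _ => ⟨x, rfl⟩)
  refine hbot ⟨⊤, inferInstance, inferInstance, 0, ?_⟩
  rw [Subgroup.lowerCentralSeries_zero, htop]

/-- **Theorem 2.1 (Osin).** Any finitely generated elementary amenable group of zero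
algebraic entropy (i.e. with `ω(G) = 1`) contains a nilpotent subgroup of finite index. -/
theorem fg_elementaryAmenable_zero_entropy_virtually_nilpotent
    {G : Type u} [inst : Group G] (hfg : Group.FG G)
    (hEA : ElementaryAmenable G inst) (hω : minGrowthRate G = 1) :
    ∃ H : Subgroup G, H.FiniteIndex ∧ Group.IsNilpotent H := by
  obtain ⟨H, -, hfi, s, hs⟩ :=
    (hasNoShortFreePairs_of_minGrowthRate_eq_one hω).virtuallyNilpotentModulo_bot
      hEA.locallyDescending
  exact ⟨H, hfi, (Subgroup.isNilpotent_iff_lowerCentralSeries H).2 ⟨s, le_bot_iff.1 hs⟩⟩
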